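/- Let n ≥ 1 and let μ be a partition of n. The descent map Des on the conjugacy class C_μ ⊆ S_n admits a cyclic extension (cDes, p) if and only if μ is NOT of the form (r^s) (i.e., all parts equal to r, with s parts) for some squarefree positive integer r. -/

import Mathlib

open Finset

/-- One-line notation value of a permutation at (1-indexed) position `i`:
`oneline π i = π_i` (as a number in `{1,…,n}`), and `0` if `i` is out of range. -/
def oneline {n : ℕ} (π : Equiv.Perm (Fin n)) (i : ℕ) : ℕ :=
  if h : i - 1 < n then (π ⟨i - 1, h⟩ : ℕ) + 1 else 0

/-- The descent set `Des(π) = {i ∈ [n-1] : π_i > π_{i+1}}`. -/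
def Des {n : ℕ} (π : Equiv.Perm (Fin n)) : Finset ℕ :=
  (Finset.Icc 1 (n - 1)).filter fun i => oneline π (i + 1) < oneline π i

/-- The cyclic shift map on subsets of `[n]`, induced by `i ↦ i + 1 (mod n)`. -/
def sh (n : ℕ) (S : Finset ℕ) : Finset ℕ := S.image fun i => i % n + 1

/-- `(cDes, p)` is a cyclic extension of the descent map `DesT : T → 2^{[n-1]}`. -/
def IsCyclicExtension {T : Type*} (n : ℕ) (DesT : T → Finset ℕ)
    (cDes : T → Finset ℕ) (p : T ≃ T) : Prop :=
  ∀ t : T,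
    cDes t ⊆ Finset.Icc 1 n ∧
    cDes t ∩ Finset.Icc 1 (n - 1) = DesT t ∧
    cDes (p t) = sh n (cDes t) ∧
    cDes t ≠ ∅ ∧ cDes t ≠ Finset.Icc 1 n

/-- The descent map on `T` admits a cyclic extension. -/
def HasCyclicExtension {T : Type*} (n : ℕ) (DesT : T → Finset ℕ) : Prop :=
  ∃ (cDes : T → Finset ℕ) (p : T ≃ T), IsCyclicExtension n DesT cDes p

/-- The cycle type of a permutation, including fixed points as parts equal to `1`;
a multiset of parts summing to `n`. -/
def fullCycleType {n : ℕ} (π : Equiv.Perm (Fin n)) : Multiset ℕ :=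
  π.cycleType + Multiset.replicate (n - π.support.card) 1

theorem exists_equiv_of_card_fiber {α β γ : Type*} [Finite α] [Finite β] (f : α → γ) (g : β → γ)
    (h : ∀ c, Nat.card {a // f a = c} = Nat.card {b // g b = c}) :
    ∃ e : α ≃ β, ∀ a, g (e a) = f a := by
  have e : ∀ c, {a // f a = c} ≃ {b // g b = c} := fun c => (Finite.card_eq.1 (h c)).some
  refine ⟨(Equiv.sigmaFiberEquiv f).symm.trans
    ((Equiv.sigmaCongrRight e).trans (Equiv.sigmaFiberEquiv g)), fun a => ?_⟩
  exact (e (f a) ⟨a, rfl⟩).2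

theorem Monotone.eq_of_card_fiber {L : Type*} [LinearOrder L] {n : ℕ} {f g : Fin n → L}
    (hf : Monotone f) (hg : Monotone g)
    (h : ∀ c, Nat.card {a // f a = c} = Nat.card {b // g b = c}) : f = g := by
  obtain ⟨e, he⟩ := exists_equiv_of_card_fiber f g h
  have h1 : g ∘ e = f := funext he
  have := Tuple.unique_monotone (f := g) (σ := e) (τ := Equiv.refl _) (by rw [h1]; exact hf)
    (by simpa using hg)
  rw [h1] at this
  simpa using this

theorem strictMono_equiv_fin_eq {n : ℕ} (e : Fin n ≃ Fin n) (he : StrictMono e) (x : Fin n) :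
    e x = x := by
  have := Subsingleton.elim (StrictMono.orderIsoOfSurjective e he e.surjective) (OrderIso.refl _)
  exact congrArg (fun t : Fin n ≃o Fin n => t x) this

section GesselReutenauer

variable {Ω L : Type*} {n : ℕ}

/-- All words read along the cycles of `σ` are primitive. -/
def IsPrim (σ : Equiv.Perm Ω) (g : Ω → L) : Prop :=
  ∀ x (m : ℕ), (∀ j : ℕ, g ((σ ^ j) ((σ ^ m) x)) = g ((σ ^ j) x)) → (σ ^ m) x = x

/-- The permutations commuting with `σ` and fixing `g`. -/
def CentStab (σ : Equiv.Perm Ω) (g : Ω → L) : Type _ :=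
  {z : Equiv.Perm Ω // (∀ x, z (σ x) = σ (z x)) ∧ ∀ x, g (z x) = g x}

/-- The infinite word read from `x` along the cycles of `σ`, in lexicographic order. -/
def orbitWord (σ : Equiv.Perm Ω) (g : Ω → L) (x : Ω) : Lex (ℕ → L) :=
  toLex fun j => g ((σ ^ j) x)

theorem orbitWord_eq_iff {σ : Equiv.Perm Ω} {g : Ω → L} {x y : Ω} :
    orbitWord σ g x = orbitWord σ g y ↔ ∀ j : ℕ, g ((σ ^ j) x) = g ((σ ^ j) y) := by
  unfold orbitWord
  rw [toLex_inj, funext_iff]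

theorem orbitWord_eq_of_apply [Finite Ω] {σ : Equiv.Perm Ω} {g : Ω → L} {x y : Ω}
    (h : orbitWord σ g (σ x) = orbitWord σ g (σ y)) : orbitWord σ g x = orbitWord σ g y := by
  rw [orbitWord_eq_iff] at h ⊢
  have hp := orderOf_pos σ
  have h1 : ∀ (j : ℕ) z, (σ ^ (j + (orderOf σ - 1))) (σ z) = (σ ^ j) z := fun j z => by
    rw [← Equiv.Perm.mul_apply, ← pow_succ, add_assoc, Nat.sub_add_cancel hp, pow_add,
      pow_orderOf_eq_one, mul_one]
  intro j
  simpa only [h1] using h (j + (orderOf σ - 1))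

variable [LinearOrder L]

/-- The labelling `τ` sorts the elements of `Ω` by the words read along the cycles of `σ`. -/
def Compat (σ : Equiv.Perm Ω) (g : Ω → L) (τ : Ω ≃ Fin n) : Prop :=
  ∀ x y, τ x < τ y → g x < g y ∨ (g x = g y ∧ τ (σ x) < τ (σ y))

theorem Compat.pow {σ : Equiv.Perm Ω} {g : Ω → L} {τ : Ω ≃ Fin n} (h : Compat σ g τ) {x y : Ω}
    (hxy : τ x < τ y) (i : ℕ) (hg : ∀ j < i, g ((σ ^ j) y) = g ((σ ^ j) x)) :
    τ ((σ ^ i) x) < τ ((σ ^ i) y) := by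
  induction i with
  | zero => simpa using hxy
  | succ i ih =>
    have h1 := h _ _ (ih fun j hj => hg j (by omega))
    rw [hg i (by omega)] at h1
    simpa [pow_succ', Equiv.Perm.mul_apply] using h1

theorem Compat.isPrim {σ : Equiv.Perm Ω} {g : Ω → L} {τ : Ω ≃ Fin n} (h : Compat σ g τ) :
    IsPrim σ g := by
  intro x m hm
  by_contra hne
  have key : ∀ k j : ℕ, g ((σ ^ j) ((σ ^ (m * k)) x)) = g ((σ ^ j) x) := by
    intro k
    induction k with
    | zero => simp
    | succ k ih =>
      intro j
      have := hm (j + m * k)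
      rw [mul_add, mul_one, pow_add, Equiv.Perm.mul_apply, ← Equiv.Perm.mul_apply, ← pow_add,
        this, pow_add, Equiv.Perm.mul_apply, ih]
  have hc : ∀ k, (σ ^ (m * k)) ((σ ^ m) x) = (σ ^ (m * (k + 1))) x := fun k => by
    rw [mul_add, mul_one, pow_add, Equiv.Perm.mul_apply]
  have hne' : τ ((σ ^ m) x) ≠ τ x := fun h => hne (τ.injective h)
  rcases lt_or_gt_of_ne hne' with hlt | hlt
  · have : StrictAnti fun k => τ ((σ ^ (m * k)) x) := strictAnti_nat_of_succ_lt fun k => by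
      rw [← hc]
      exact h.pow hlt _ fun j _ => (hm j).symm
    exact not_injective_infinite_finite _ this.injective
  · have : StrictMono fun k => τ ((σ ^ (m * k)) x) := strictMono_nat_of_lt_succ fun k => by
      rw [← hc]
      exact h.pow hlt _ fun j _ => hm j
    exact not_injective_infinite_finite _ this.injective

theorem orbitWord_lt_iff {σ : Equiv.Perm Ω} {g : Ω → L} {x y : Ω} :
    orbitWord σ g x < orbitWord σ g y ↔
      ∃ i : ℕ, (∀ j < i, g ((σ ^ j) x) = g ((σ ^ j) y)) ∧ g ((σ ^ i) x) < g ((σ ^ i) y) :=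
  Iff.rfl

theorem Compat.orbitWord_le {σ : Equiv.Perm Ω} {g : Ω → L} {τ : Ω ≃ Fin n} (h : Compat σ g τ)
    {x y : Ω} (hxy : τ x < τ y) : orbitWord σ g x ≤ orbitWord σ g y := by
  by_contra hlt
  obtain ⟨i, hi, hi'⟩ := orbitWord_lt_iff.1 (not_le.1 hlt)
  rcases h _ _ (h.pow hxy i hi) with h1 | h1
  · exact lt_asymm h1 hi'
  · exact absurd h1.1 hi'.ne'

theorem Compat.monotone {σ : Equiv.Perm Ω} {g : Ω → L} {τ : Ω ≃ Fin n} (h : Compat σ g τ) :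
    Monotone (orbitWord σ g ∘ τ.symm) :=
  monotone_iff_forall_lt.2 fun a b hab => h.orbitWord_le (by simpa using hab)

theorem card_compat_of_compat [Finite Ω] {σ : Equiv.Perm Ω} {g : Ω → L} {τ₀ : Ω ≃ Fin n}
    (h₀ : Compat σ g τ₀) :
    Nat.card {τ : Ω ≃ Fin n // Compat σ g τ} = Nat.card (CentStab σ g) := by
  symm
  refine Nat.card_congr (Equiv.ofBijective (fun z => ⟨z.1.trans τ₀, ?_⟩) ⟨?_, ?_⟩)
  · intro x y hxy
    have := h₀ _ _ hxy
    rw [z.2.2, z.2.2, ← z.2.1, ← z.2.1] at this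
    exact this
  · intro z w h
    apply Subtype.ext
    ext x
    have := congrArg (fun e => e.1 x) h
    exact τ₀.injective this
  · rintro ⟨τ, h⟩
    let z : Equiv.Perm Ω := τ.trans τ₀.symm
    have hz : ∀ x, τ₀ (z x) = τ x := fun x => by simp [z]
    have hs : ∀ x, orbitWord σ g (z x) = orbitWord σ g x := by
      intro x
      have := Tuple.unique_monotone (f := orbitWord σ g ∘ τ₀.symm) (σ := 1)
        (τ := τ.symm.trans τ₀) (by simpa using h₀.monotone)
        (by convert h.monotone using 1; ext; simp)
      have := congrFun this (τ x)
      simpa [z] using this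
    let u : Equiv.Perm Ω := σ.trans (z.trans σ.symm)
    have hu : ∀ x, σ (u x) = z (σ x) := fun x => by simp [u]
    have hsu : ∀ x, orbitWord σ g (u x) = orbitWord σ g x := fun x =>
      orbitWord_eq_of_apply (by rw [hu, hs])
    have hgu : ∀ x, g (u x) = g x := fun x => by simpa using orbitWord_eq_iff.1 (hsu x) 0
    have hgz : ∀ x, g (z x) = g x := fun x => by simpa using orbitWord_eq_iff.1 (hs x) 0
    have hmono : ∀ x y, τ x < τ y → τ₀ (u x) < τ₀ (u y) := by
      intro x y hxy
      by_contra hlt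
      have hne : τ₀ (u y) ≠ τ₀ (u x) := fun h => by
        have := u.injective (τ₀.injective h)
        rw [this] at hxy
        exact lt_irrefl _ hxy
      have h1 := h₀ _ _ (lt_of_le_of_ne (not_lt.1 hlt) hne)
      rw [hgu, hgu, hu, hu, hz, hz] at h1
      have h2 := h _ _ hxy
      rcases h1 with h1 | h1 <;> rcases h2 with h2 | h2
      · exact lt_asymm h1 h2
      · exact absurd h2.1 h1.ne'
      · exact absurd h1.1 h2.ne'
      · exact lt_asymm h1.2 h2.2
    have huz : ∀ x, u x = z x := by
      intro x
      have := strictMono_equiv_fin_eq (τ.symm.trans (u.trans τ₀))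
        (fun a b hab => hmono _ _ (by simpa using hab)) (τ x)
      apply τ₀.injective
      rw [hz]
      simpa using this
    refine ⟨⟨z, fun x => ?_, hgz⟩, ?_⟩
    · rw [← hu, huz]
    · apply Subtype.ext
      ext x
      simp [z]

theorem exists_compat [Finite Ω] {σ : Equiv.Perm Ω} {g : Ω → L} (hn : Nat.card Ω = n)
    (h : IsPrim σ g) : ∃ τ : Ω ≃ Fin n, Compat σ g τ := by
  classical
  have := Fintype.ofFinite Ω
  let Q := Quotient (Equiv.Perm.SameCycle.setoid σ)
  let lab : Ω → Fin (Nat.card Q) := fun x => Finite.equivFin Q (Quotient.mk _ x)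
  have hlab : ∀ x, lab (σ x) = lab x := fun x => by
    apply congrArg (Finite.equivFin Q)
    exact Quotient.sound (Equiv.Perm.sameCycle_apply_left.2 (Equiv.Perm.SameCycle.refl σ x))
  let key : Ω → Lex (Lex (ℕ → L) × Fin (Nat.card Q)) := fun x => toLex (orbitWord σ g x, lab x)
  have hinj : Function.Injective key := by
    intro x y hxy
    have h1 : orbitWord σ g x = orbitWord σ g y ∧ lab x = lab y := by
      simpa [key, Prod.ext_iff] using hxy
    have h2 : σ.SameCycle x y := Quotient.exact ((Finite.equivFin Q).injective h1.2)
    obtain ⟨m, hm⟩ := h2.exists_nat_pow_eq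
    rw [← hm]
    refine (h x m fun j => ?_).symm
    rw [hm]
    exact (orbitWord_eq_iff.1 h1.1 j).symm
  let : LinearOrder Ω := LinearOrder.lift' key hinj
  have hcard : Fintype.card Ω = n := by rw [← Nat.card_eq_fintype_card, hn]
  let e := Fintype.orderIsoFinOfCardEq Ω hcard
  have he : ∀ x y, e.symm x < e.symm y ↔ key x < key y := fun x y => e.symm.lt_iff_lt
  refine ⟨e.symm.toEquiv, fun x y hxy => ?_⟩
  change g x < g y ∨ g x = g y ∧ e.symm (σ x) < e.symm (σ y)
  have hxy' := (he x y).1 hxy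
  rw [he]
  simp only [key, Prod.Lex.toLex_lt_toLex] at hxy' ⊢
  rw [hlab, hlab]
  rcases hxy' with hlt | ⟨heq, hlt⟩
  · obtain ⟨i, hi, hi'⟩ := orbitWord_lt_iff.1 hlt
    cases i with
    | zero => left; simpa using hi'
    | succ i =>
      right
      refine ⟨by simpa using hi 0 (by omega), Or.inl ?_⟩
      refine orbitWord_lt_iff.2 ⟨i, fun j hj => ?_, ?_⟩
      · simpa [pow_succ] using hi (j + 1) (by omega)
      · simpa [pow_succ] using hi'
  · rw [orbitWord_eq_iff] at heq
    right
    refine ⟨by simpa using heq 0, Or.inr ⟨?_, hlt⟩⟩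
    rw [orbitWord_eq_iff]
    intro j
    simpa [pow_succ] using heq (j + 1)

open scoped Classical in
theorem card_compat [Finite Ω] (σ : Equiv.Perm Ω) (g : Ω → L) (hn : Nat.card Ω = n) :
    Nat.card {τ : Ω ≃ Fin n // Compat σ g τ} =
      if IsPrim σ g then Nat.card (CentStab σ g) else 0 := by
  split_ifs with h
  · obtain ⟨τ, hτ⟩ := exists_compat hn h
    exact card_compat_of_compat hτ
  · have : IsEmpty {τ : Ω ≃ Fin n // Compat σ g τ} := ⟨fun τ => h τ.2.isPrim⟩
    exact Nat.card_of_isEmpty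

end GesselReutenauer

section Blocks

variable {n : ℕ} [NeZero n]

/-- The cyclic shift of a subset of `Fin n` by `c`. -/
def rot (c : Fin n) (J : Finset (Fin n)) : Finset (Fin n) :=
  J.map (Equiv.addRight c).toEmbedding

theorem mem_rot {c p : Fin n} {J : Finset (Fin n)} : p ∈ rot c J ↔ p - c ∈ J := by
  simp [rot, mem_map_equiv, sub_eq_add_neg]

theorem rot_rot (c d : Fin n) (J : Finset (Fin n)) : rot c (rot d J) = rot (d + c) J := by
  ext p
  simp only [mem_rot, sub_sub]
  rw [add_comm c d]

theorem rot_zero (J : Finset (Fin n)) : rot 0 J = J := by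
  ext p
  simp [mem_rot]

theorem rot_subset_iff {c : Fin n} {J I : Finset (Fin n)} : rot c J ⊆ I ↔ J ⊆ rot (-c) I := by
  constructor
  · intro h p hp
    rw [mem_rot]
    exact h (by rw [mem_rot]; simpa using hp)
  · intro h p hp
    have := h (mem_rot.1 hp)
    simpa [mem_rot] using this

theorem Fin.val_sub_one_of_ne {p : Fin n} (hp : p ≠ 0) : ((p - 1 : Fin n) : ℕ) = p - 1 :=
  Fin.val_sub_one_of_ne_zero hp

/-- The largest element of `I` that is at most `p`. -/
noncomputable def blockStart (I : Finset (Fin n)) (p : Fin n) : Fin n := (I.filter (· ≤ p)).sup id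

variable {I : Finset (Fin n)}

theorem blockStart_mem (h0 : 0 ∈ I) (p : Fin n) : blockStart I p ∈ I := by
  have hne : (I.filter (· ≤ p)).Nonempty := ⟨0, by simp [h0]⟩
  obtain ⟨i, hi, h⟩ := exists_mem_eq_sup _ hne id
  rw [blockStart, h]
  exact (mem_filter.1 hi).1

theorem blockStart_le (p : Fin n) : blockStart I p ≤ p :=
  Finset.sup_le fun _ hi => (mem_filter.1 hi).2

theorem le_blockStart {i p : Fin n} (hi : i ∈ I) (hp : i ≤ p) : i ≤ blockStart I p :=
  Finset.le_sup (f := id) (mem_filter.2 ⟨hi, hp⟩)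

theorem blockStart_mono (I : Finset (Fin n)) : Monotone (blockStart I) := fun _ _ h =>
  Finset.sup_mono fun _ hi =>
    mem_filter.2 ⟨(mem_filter.1 hi).1, (mem_filter.1 hi).2.trans h⟩

theorem blockStart_of_mem {i : Fin n} (hi : i ∈ I) : blockStart I i = i :=
  le_antisymm (blockStart_le _) (le_blockStart hi le_rfl)

theorem blockStart_eq_iff (h0 : 0 ∈ I) {i p : Fin n} :
    blockStart I p = i ↔ i ∈ I ∧ i ≤ p ∧ ∀ j ∈ I, j ≤ p → j ≤ i := by
  constructor
  · rintro rfl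
    exact ⟨blockStart_mem h0 p, blockStart_le p, fun j hj hp => le_blockStart hj hp⟩
  · rintro ⟨h1, h2, h3⟩
    exact le_antisymm (h3 _ (blockStart_mem h0 p) (blockStart_le p)) (le_blockStart h1 h2)

theorem blockStart_sub_one {p : Fin n} (hp : p ≠ 0) (hI : p ∉ I) (h0 : 0 ∈ I) :
    blockStart I (p - 1) = blockStart I p := by
  have hv := Fin.val_sub_one_of_ne hp
  have hp' : 0 < (p : ℕ) := Nat.pos_of_ne_zero fun h => hp (Fin.ext (by simpa using h))
  refine le_antisymm (blockStart_mono I (by rw [Fin.le_def]; omega))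
    (le_blockStart (blockStart_mem h0 p) ?_)
  have h1 := blockStart_le (I := I) p
  have h2 : blockStart I p ≠ p := fun h => hI (h ▸ blockStart_mem h0 p)
  have h3 := lt_of_le_of_ne h1 h2
  rw [Fin.lt_def] at h3
  rw [Fin.le_def]
  omega

theorem Fin.val_sub_cases {n : ℕ} (a c : Fin n) :
    ((c : ℕ) ≤ a ∧ ((a - c : Fin n) : ℕ) = a - c) ∨
      ((a : ℕ) < c ∧ ((a - c : Fin n) : ℕ) = n + a - c) := by
  rcases le_or_gt c a with h | h
  · exact Or.inl ⟨h, Fin.sub_val_of_le h⟩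
  · refine Or.inr ⟨h, ?_⟩
    have := c.2
    rw [Fin.lt_def] at h
    rw [Fin.sub_def]
    simp only
    rw [Nat.mod_eq_of_lt] <;> omega

theorem blockStart_rot (h0 : 0 ∈ I) {c : Fin n} (hc : c ∈ I) (p : Fin n) :
    blockStart (rot (-c) I) (p - c) = blockStart I p - c := by
  have h0' : (0 : Fin n) ∈ rot (-c) I := by simpa [mem_rot] using hc
  have hb := blockStart_mem h0 p
  have hbp := blockStart_le (I := I) p
  rw [blockStart_eq_iff h0']
  refine ⟨by simpa [mem_rot] using hb, ?_, fun j hj hjp => ?_⟩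
  · by_cases hcp : c ≤ p
    · have := le_blockStart hc hcp
      rw [Fin.le_def] at *
      rcases Fin.val_sub_cases p c with h | h <;>
      rcases Fin.val_sub_cases (blockStart I p) c with h' | h' <;> omega
    · rw [Fin.le_def] at *
      rcases Fin.val_sub_cases p c with h | h <;>
      rcases Fin.val_sub_cases (blockStart I p) c with h' | h' <;> omega
  · obtain ⟨k, rfl⟩ : ∃ k, j = k - c := ⟨j + c, by simp⟩
    have hk : k ∈ I := by simpa [mem_rot] using hj
    have h1 := fun h => le_blockStart (p := p) hk h
    have h2 := fun h => le_blockStart (p := p) hc h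
    rw [Fin.le_def] at *
    have := k.2
    have := p.2
    simp only [Fin.le_def] at h1 h2
    rcases Fin.val_sub_cases p c with h | h <;>
    rcases Fin.val_sub_cases k c with h'' | h'' <;>
    rcases Fin.val_sub_cases (blockStart I p) c with h' | h' <;> omega

end Blocks

section WeightedCount

variable {Ω K : Type*} [LinearOrder K] {n : ℕ} [NeZero n]

/-- The sorting key of the element at a position. -/
def sortKey (σ : Equiv.Perm Ω) (κ : Ω → K) (τ : Ω ≃ Fin n) (x : Ω) : K ×ₗ Fin n :=
  toLex (κ x, τ (σ x))

theorem sortKey_injective (σ : Equiv.Perm Ω) (κ : Ω → K) (τ : Ω ≃ Fin n) :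
    Function.Injective (sortKey σ κ τ) := by
  intro x y h
  have h1 : κ x = κ y ∧ τ (σ x) = τ (σ y) := by simpa [sortKey, Prod.ext_iff] using h
  exact σ.injective (τ.injective h1.2)

/-- Descents of the sequence of sorting keys. -/
def keyDes (σ : Equiv.Perm Ω) (κ : Ω → K) (τ : Ω ≃ Fin n) : Finset (Fin n) :=
  univ.filter fun i => i ≠ 0 ∧ sortKey σ κ τ (τ.symm i) < sortKey σ κ τ (τ.symm (i - 1))

/-- Pairs of labels. -/
def pairLabel {Ω K M : Type*} (f : Ω → M) (κ : Ω → K) (x : Ω) : M ×ₗ K := toLex (f x, κ x)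

theorem compat_pairLabel_iff {σ : Equiv.Perm Ω} {κ : Ω → K} {τ : Ω ≃ Fin n} {M : Type*}
    [LinearOrder M] {f : Ω → M} : Compat σ (pairLabel f κ) τ ↔ ∀ x y, τ x < τ y →
      f x < f y ∨ f x = f y ∧ sortKey σ κ τ x < sortKey σ κ τ y := by
  unfold Compat
  refine forall_congr' fun x => forall_congr' fun y => imp_congr_right fun _ => ?_
  simp only [pairLabel, sortKey, Prod.Lex.toLex_lt_toLex, toLex_inj, Prod.mk.injEq]
  tauto

theorem keyDes_subset_iff {σ : Equiv.Perm Ω} {κ : Ω → K} {τ : Ω ≃ Fin n}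
    {I : Finset (Fin n)} (h0 : 0 ∈ I) :
    keyDes σ κ τ ⊆ I ↔ Compat σ (pairLabel (fun x => blockStart I (τ x)) κ) τ := by
  rw [compat_pairLabel_iff]
  constructor
  · intro h
    have key : ∀ (q : ℕ) (hq : q < n) (p : Fin n), p < ⟨q, hq⟩ →
        blockStart I p = blockStart I ⟨q, hq⟩ →
        sortKey σ κ τ (τ.symm p) < sortKey σ κ τ (τ.symm ⟨q, hq⟩) := by
      intro q
      induction q with
      | zero =>
        intro hq p hp
        exact absurd hp (by rw [Fin.lt_def]; simp)
      | succ k ih =>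
        intro hq p hp hpq
        have hne : (⟨k + 1, hq⟩ : Fin n) ≠ 0 := fun h => by simpa using congrArg Fin.val h
        have hk : (⟨k + 1, hq⟩ - 1 : Fin n) = ⟨k, by omega⟩ := by
          ext
          rw [Fin.val_sub_one_of_ne hne]
          simp
        have hpk : p ≤ ⟨k, by omega⟩ := by
          rw [Fin.lt_def] at hp
          rw [Fin.le_def]
          simp at hp ⊢
          omega
        have hI : (⟨k + 1, hq⟩ : Fin n) ∉ I := fun hI => by
          rw [blockStart_of_mem hI] at hpq
          exact absurd (hpq ▸ blockStart_le p) (not_le.2 hp)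
        have hb := blockStart_sub_one hne hI h0
        rw [hk] at hb
        have hd : (⟨k + 1, hq⟩ : Fin n) ∉ keyDes σ κ τ := fun hd => hI (h hd)
        have hlt : sortKey σ κ τ (τ.symm ⟨k, by omega⟩) <
            sortKey σ κ τ (τ.symm ⟨k + 1, hq⟩) := by
          simp only [keyDes, mem_filter, mem_univ, true_and, not_and, hk] at hd
          refine lt_of_le_of_ne (not_lt.1 (hd hne)) fun he => ?_
          have := τ.symm.injective (sortKey_injective σ κ τ he)
          simp at this
        rcases hpk.lt_or_eq with hlt' | heq
        · exact (ih _ p hlt' (hpq.trans hb.symm)).trans hlt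
        · rw [heq]
          exact hlt
    intro x y hxy
    rcases (blockStart_mono I hxy.le).lt_or_eq with hlt | heq
    · exact Or.inl hlt
    · refine Or.inr ⟨heq, ?_⟩
      simpa using key (τ y) (τ y).2 (τ x) hxy heq
  · intro h i hi
    simp only [keyDes, mem_filter, mem_univ, true_and] at hi
    by_contra hI
    have hv := Fin.val_sub_one_of_ne hi.1
    have hp' : 0 < (i : ℕ) := Nat.pos_of_ne_zero fun h => hi.1 (Fin.ext (by simpa using h))
    have h1 := h (τ.symm (i - 1)) (τ.symm i) (by
      rw [τ.apply_symm_apply, τ.apply_symm_apply, Fin.lt_def]; omega)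
    rw [τ.apply_symm_apply, τ.apply_symm_apply, blockStart_sub_one hi.1 hI h0] at h1
    rcases h1 with h1 | h1
    · exact lt_irrefl _ h1
    · exact lt_asymm h1.2 hi.2

/-- Two functions take every value equally often. -/
def SameContent {α β γ : Type*} (f : α → γ) (g : β → γ) : Prop :=
  ∀ c, Nat.card {a // f a = c} = Nat.card {b // g b = c}

theorem SameContent.symm {α β γ : Type*} {f : α → γ} {g : β → γ} (h : SameContent f g) :
    SameContent g f := fun c => (h c).symm

theorem SameContent.trans {α β δ γ : Type*} {f : α → γ} {g : β → γ} {k : δ → γ}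
    (h : SameContent f g) (h' : SameContent g k) : SameContent f k := fun c => (h c).trans (h' c)

theorem sameContent_comp_equiv {α β γ : Type*} (g : β → γ) (e : α ≃ β) :
    SameContent (fun a => g (e a)) g := fun c =>
  Nat.card_congr (e.subtypeEquiv fun _ => Iff.rfl)

theorem SameContent.comp {α β γ δ : Type*} {f : α → γ} {g : β → γ} [Finite α] [Finite β]
    (h : SameContent f g) (φ : γ → δ) : SameContent (fun a => φ (f a)) (fun b => φ (g b)) := by
  obtain ⟨e, he⟩ := exists_equiv_of_card_fiber f g h
  have := sameContent_comp_equiv (fun b => φ (g b)) e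
  simpa [he] using this

theorem Compat.eq_blockStart {σ : Equiv.Perm Ω} {κ : Ω → K} {τ : Ω ≃ Fin n} {f : Ω → Fin n}
    {I : Finset (Fin n)} (h : Compat σ (pairLabel f κ) τ) (hf : SameContent f (blockStart I)) :
    f = fun x => blockStart I (τ x) := by
  have hm : Monotone (fun p => f (τ.symm p)) := monotone_iff_forall_lt.2 fun p q hpq => by
    have := compat_pairLabel_iff.1 h (τ.symm p) (τ.symm q) (by simpa using hpq)
    rcases this with h | h
    · exact h.le
    · exact h.1.le
  have := Monotone.eq_of_card_fiber hm (blockStart_mono I)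
    ((sameContent_comp_equiv f τ.symm).trans hf)
  funext x
  simpa using congrFun this (τ x)

/-- The number of compatible labellings. -/
noncomputable def sortCount (n : ℕ) {L : Type*} [LinearOrder L] (σ : Equiv.Perm Ω) (g : Ω → L) :
    ℕ := Nat.card {τ : Ω ≃ Fin n // Compat σ g τ}

open scoped Classical in
theorem sum_keyDes_subset [Fintype Ω] (σ : Equiv.Perm Ω) (κ : Ω → K) {I : Finset (Fin n)}
    (h0 : 0 ∈ I) (W : (Ω ≃ Fin n) → ℚ) (w : (Ω → Fin n) → ℚ)
    (hw : ∀ (f : Ω → Fin n) (τ : Ω ≃ Fin n), SameContent f (blockStart I) →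
      Compat σ (pairLabel f κ) τ → W τ = w f) :
    ∑ τ : Ω ≃ Fin n, (if keyDes σ κ τ ⊆ I then W τ else 0) =
      ∑ f : Ω → Fin n, if SameContent f (blockStart I) then
        w f * sortCount n σ (pairLabel f κ) else 0 := by
  have h1 : ∀ τ : Ω ≃ Fin n, (if keyDes σ κ τ ⊆ I then W τ else 0) =
      ∑ f : Ω → Fin n, if SameContent f (blockStart I) ∧ Compat σ (pairLabel f κ) τ then
        w f else 0 := by
    intro τ
    rw [Finset.sum_eq_single (fun x => blockStart I (τ x))]
    · have hc := sameContent_comp_equiv (blockStart I) τ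
      by_cases h : keyDes σ κ τ ⊆ I
      · have h' := (keyDes_subset_iff h0).1 h
        rw [if_pos h, if_pos ⟨hc, h'⟩]
        exact hw _ _ hc h'
      · rw [if_neg h, if_neg fun h' => h ((keyDes_subset_iff h0).2 h'.2)]
    · intro f _ hf
      exact if_neg fun h => hf (h.2.eq_blockStart h.1)
    · simp
  rw [Finset.sum_congr rfl fun τ _ => h1 τ, Finset.sum_comm]
  refine Finset.sum_congr rfl fun f _ => ?_
  by_cases h : SameContent f (blockStart I)
  · simp only [h, true_and, if_true]
    rw [← Finset.sum_filter, Finset.sum_const, nsmul_eq_mul, mul_comm, sortCount,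
      Nat.card_eq_fintype_card, Fintype.card_subtype]
  · simp [h]

end WeightedCount

section Transitions

variable {Ω K : Type*} [LinearOrder K] {n : ℕ} [NeZero n]

/-- Cyclically, a block containing an element of `A` is followed by the block labelled `0`,
which contains an element outside `A`. -/
def IsTransition (A : Ω → Prop) (g : Ω → Fin n) : Prop :=
  (∃ b, ¬ A b ∧ g b = 0) ∧ ∃ a, A a ∧ ∀ x, g x ≤ g a

theorem isTransition_comp_equiv {A : Ω → Prop} {g g' : Ω → Fin n} (e : Equiv.Perm Ω)
    (hA : ∀ x, A (e x) ↔ A x) (hg : ∀ x, g' (e x) = g x) :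
    IsTransition A g' ↔ IsTransition A g := by
  unfold IsTransition
  rw [← e.exists_congr_right, ← e.exists_congr_right (q := fun a => A a ∧ ∀ x, g' x ≤ g' a)]
  simp only [hA, hg]
  refine and_congr_right fun _ => exists_congr fun a => and_congr_right fun _ => ?_
  rw [← e.forall_congr_right]
  simp only [hg]

theorem exists_isTransition [Finite Ω] {A : Ω → Prop} {a₀ b₀ : Ω} (ha : A a₀) (hb : ¬ A b₀)
    (f : Ω → Fin n) : ∃ c, IsTransition A (fun x => f x - c) := by
  have : Nonempty ({a // A a} × {b // ¬ A b}) := ⟨⟨a₀, ha⟩, ⟨b₀, hb⟩⟩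
  obtain ⟨⟨⟨a, ha⟩, ⟨b, hb⟩⟩, hmax⟩ := Finite.exists_max
    (fun p : {a // A a} × {b // ¬ A b} => f p.1 - f p.2)
  refine ⟨f b, ⟨b, hb, sub_self _⟩, a, ha, fun x => ?_⟩
  by_cases hx : A x
  · exact hmax ⟨⟨x, hx⟩, ⟨b, hb⟩⟩
  · have := hmax ⟨⟨a, ha⟩, ⟨x, hx⟩⟩
    by_contra hcon
    simp only [not_le, Fin.le_def] at this hcon
    have := (f x).2
    have := (f a).2
    have := (f b).2
    rcases Fin.val_sub_cases (f a) (f b) with h | h <;>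
    rcases Fin.val_sub_cases (f x) (f b) with h' | h' <;>
    rcases Fin.val_sub_cases (f a) (f x) with h'' | h'' <;> omega

theorem Fin.sub_le_neg_one (p c : Fin n) : p - c ≤ -1 := by
  have h1 : (-1 : Fin n) = 0 - 1 := by simp
  have := NeZero.pos n
  rw [Fin.le_def]
  by_cases hn : n = 1
  · subst hn
    omega
  · have h2 : ((1 : Fin n) : ℕ) = 1 := by
      rw [Fin.val_one', Nat.mod_eq_of_lt]; omega
    have h3 : ((0 : Fin n) : ℕ) = 0 := by simp
    rcases Fin.val_sub_cases (0 : Fin n) 1 with h | h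
    · omega
    · have := (p - c).2
      rw [h1]
      omega

theorem isTransition_equiv_iff {A : Ω → Prop} {τ : Ω ≃ Fin n} {c : Fin n} :
    IsTransition A (fun x => τ x - c) ↔ ¬ A (τ.symm c) ∧ A (τ.symm (c - 1)) := by
  refine and_congr ⟨?_, fun h => ⟨_, h, by simp⟩⟩ ⟨?_, fun h => ⟨_, h, fun x => ?_⟩⟩
  · rintro ⟨b, hb, h⟩
    rw [sub_eq_zero] at h
    rwa [← h, τ.symm_apply_apply]
  · rintro ⟨a, ha, h⟩
    have h1 : τ a - c = -1 := le_antisymm (Fin.sub_le_neg_one _ _) (by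
      simpa using h (τ.symm (c - 1)))
    have h2 : τ a = c - 1 := by rw [← sub_add_cancel (τ a) c, h1]; abel
    rwa [← h2, τ.symm_apply_apply]
  · simpa using Fin.sub_le_neg_one (τ x) c

theorem isTransition_blockStart_iff {A : Ω → Prop} {σ : Equiv.Perm Ω} {κ : Ω → K}
    (hκ : ∀ a b, A a → ¬ A b → κ b < κ a) {I : Finset (Fin n)} (h0 : 0 ∈ I) {τ : Ω ≃ Fin n}
    (h : Compat σ (pairLabel (fun x => blockStart I (τ x)) κ) τ) (c : Fin n) :
    IsTransition A (fun x => blockStart I (τ x) - c) ↔ IsTransition A (fun x => τ x - c) := by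
  rw [compat_pairLabel_iff] at h
  have hlt : ∀ x y, τ x < τ y → blockStart I (τ x) = blockStart I (τ y) → A x → A y := by
    intro x y hxy he hx
    by_contra hy
    have := (h x y hxy).resolve_left (by rw [he]; exact lt_irrefl _)
    have h2 := hκ _ _ hx hy
    rcases Prod.Lex.toLex_lt_toLex.1 this.2 with h3 | h3
    · exact lt_asymm h2 h3
    · exact h2.ne' h3.1
  constructor
  · rintro ⟨⟨b, hb, hbc⟩, a, ha, hmax⟩
    rw [sub_eq_zero] at hbc
    have hc : c ∈ I := hbc ▸ blockStart_mem h0 _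
    rw [isTransition_equiv_iff]
    constructor
    · intro hA
      have h1 : τ b ≠ c := fun h => hb (by rwa [← h, τ.symm_apply_apply] at hA)
      refine hb (hlt (τ.symm c) b ?_ ?_ hA)
      · rw [τ.apply_symm_apply]
        exact lt_of_le_of_ne (hbc ▸ blockStart_le _) h1.symm
      · rw [τ.apply_symm_apply, hbc, blockStart_of_mem hc]
    · by_contra hA
      have h1 : τ a ≠ c - 1 := fun h => hA (by rwa [← h, τ.symm_apply_apply])
      have h2 : τ a - c < -1 := lt_of_le_of_ne (Fin.sub_le_neg_one _ _) fun h => h1 (by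
        rw [← sub_add_cancel (τ a) c, h]; abel)
      have h3 := hmax (τ.symm (c - 1))
      beta_reduce at h3
      rw [τ.apply_symm_apply, ← blockStart_rot h0 hc, ← blockStart_rot h0 hc] at h3
      have h4 : (c - 1 - c : Fin n) = -1 := by abel
      have h5 := le_antisymm h3 (blockStart_mono _ (by rw [h4]; exact h2.le))
      rw [blockStart_rot h0 hc, blockStart_rot h0 hc, sub_left_inj] at h5
      refine hA (hlt a (τ.symm (c - 1)) ?_ ?_ ha)
      · rw [τ.apply_symm_apply]
        refine lt_of_le_of_ne (not_lt.1 fun h6 => ?_) h1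
        by_cases hc0 : c = 0
        · rw [hc0] at h6
          exact absurd h6 (not_lt.2 (by simpa using Fin.sub_le_neg_one (τ a) 0))
        · have hv := Fin.val_sub_one_of_ne hc0
          have hp' : 0 < (c : ℕ) := Nat.pos_of_ne_zero fun h => hc0 (Fin.ext (by simpa using h))
          have h7 := le_blockStart (p := τ a) hc (by
            rw [Fin.lt_def] at h6
            rw [Fin.le_def]
            omega)
          rw [← h5] at h7
          have h8 := h7.trans (blockStart_le _)
          rw [Fin.le_def] at h8
          omega
      · rw [τ.apply_symm_apply, h5]
  · intro hT
    have hT' := isTransition_equiv_iff.1 hT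
    have hc : c ∈ I := by
      by_contra hc
      have hc0 : c ≠ 0 := fun h => hc (h ▸ h0)
      have hv := Fin.val_sub_one_of_ne hc0
      have hp' : 0 < (c : ℕ) := Nat.pos_of_ne_zero fun h => hc0 (Fin.ext (by simpa using h))
      refine hT'.1 (hlt (τ.symm (c - 1)) _ ?_ ?_ hT'.2)
      · rw [τ.apply_symm_apply, τ.apply_symm_apply, Fin.lt_def]
        omega
      · rw [τ.apply_symm_apply, τ.apply_symm_apply, blockStart_sub_one hc0 hc h0]
    obtain ⟨⟨b, hb, hbc⟩, a, ha, hmax⟩ := hT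
    refine ⟨⟨b, hb, ?_⟩, a, ha, fun x => ?_⟩
    · rw [sub_eq_zero] at hbc ⊢
      rw [hbc, blockStart_of_mem hc]
    · beta_reduce
      rw [← blockStart_rot h0 hc, ← blockStart_rot h0 hc]
      exact blockStart_mono _ (hmax x)

end Transitions

section KernelInvariance

variable {Ω L L' : Type*}

theorem isPrim_congr {σ : Equiv.Perm Ω} {g : Ω → L} {g' : Ω → L'}
    (h : ∀ x y, g x = g y ↔ g' x = g' y) : IsPrim σ g ↔ IsPrim σ g' := by
  simp only [IsPrim, h]

theorem card_centStab_congr {σ : Equiv.Perm Ω} {g : Ω → L} {g' : Ω → L'}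
    (h : ∀ x y, g x = g y ↔ g' x = g' y) :
    Nat.card (CentStab σ g) = Nat.card (CentStab σ g') :=
  Nat.card_congr (Equiv.subtypeEquivRight fun z => by simp only [h])

theorem sortCount_congr [Finite Ω] [LinearOrder L] [LinearOrder L'] {n : ℕ}
    (hn : Nat.card Ω = n) {σ : Equiv.Perm Ω} {g : Ω → L} {g' : Ω → L'}
    (h : ∀ x y, g x = g y ↔ g' x = g' y) : sortCount n σ g = sortCount n σ g' := by
  classical
  rw [sortCount, sortCount, card_compat σ g hn, card_compat σ g' hn, card_centStab_congr h]
  simp only [isPrim_congr (σ := σ) h]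

end KernelInvariance

section Weight

variable {Ω K : Type*} [LinearOrder K] {n : ℕ} [NeZero n]

theorem sortCount_sub [Finite Ω] (hn : Nat.card Ω = n) (σ : Equiv.Perm Ω) (f : Ω → Fin n)
    (κ : Ω → K) (c : Fin n) :
    sortCount n σ (pairLabel (fun x => f x - c) κ) = sortCount n σ (pairLabel f κ) :=
  sortCount_congr hn fun x y => by simp [pairLabel]

open scoped Classical in
/-- The number of transitions, over all cyclic shifts of the labels. -/
noncomputable def transCount (A : Ω → Prop) (g : Ω → Fin n) : ℕ :=
  #{c : Fin n | IsTransition A (fun x => g x - c)}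

theorem transCount_sub (A : Ω → Prop) (g : Ω → Fin n) (c : Fin n) :
    transCount A (fun x => g x - c) = transCount A g := by
  classical
  refine card_bij' (fun d _ => c + d) (fun d _ => d - c) ?_ ?_ ?_ ?_
  · intro d hd
    simpa [sub_sub] using hd
  · intro d hd
    simpa [sub_sub] using hd
  · simp
  · simp

theorem SameContent.sub_iff {Ω : Type*} [Finite Ω] {f : Ω → Fin n} {I : Finset (Fin n)}
    (h0 : 0 ∈ I) {c : Fin n} (hc : c ∈ I) :
    SameContent (fun x => f x - c) (blockStart (rot (-c) I)) ↔ SameContent f (blockStart I) := by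
  have h1 : SameContent (fun p => blockStart I p - c) (blockStart (rot (-c) I)) := by
    have := sameContent_comp_equiv (blockStart (rot (-c) I)) (Equiv.subRight c)
    simpa [blockStart_rot h0 hc] using this
  constructor
  · intro h
    have := (h.trans h1.symm).comp (· + c)
    simpa using this
  · intro h
    exact (h.comp (· - c)).trans h1

variable [Fintype Ω]

open scoped Classical in
/-- The weight of a cyclic descent set. -/
noncomputable def cycWeight (σ : Equiv.Perm Ω) (κ : Ω → K) (A : Ω → Prop)
    (D : (Ω → Fin n) → Prop) (J : Finset (Fin n)) : ℚ :=
  ∑ τ : Ω ≃ Fin n, ∑ c : Fin n, if rot c (insert 0 (keyDes σ κ τ)) = J then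
    (if IsTransition A τ ∧ D τ then (transCount A τ : ℚ)⁻¹ else 0) else 0

variable {σ : Equiv.Perm Ω} {κ : Ω → K} {A : Ω → Prop} {D : (Ω → Fin n) → Prop}

theorem cycWeight_nonneg (J : Finset (Fin n)) : 0 ≤ cycWeight σ κ A D J := by
  unfold cycWeight
  refine sum_nonneg fun τ _ => sum_nonneg fun c _ => ?_
  split_ifs <;> positivity

theorem cycWeight_rot (c : Fin n) (J : Finset (Fin n)) :
    cycWeight σ κ A D (rot c J) = cycWeight σ κ A D J := by
  unfold cycWeight
  refine sum_congr rfl fun τ _ => ?_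
  rw [← Equiv.sum_comp (Equiv.addRight c)]
  refine sum_congr rfl fun d _ => ?_
  have : rot (Equiv.addRight c d) (insert 0 (keyDes σ κ τ)) = rot c J ↔
      rot d (insert 0 (keyDes σ κ τ)) = J := by
    rw [Equiv.coe_addRight, ← rot_rot]
    exact (Finset.map_injective _).eq_iff
  simp only [this]

theorem cycWeight_empty : cycWeight σ κ A D ∅ = 0 := by
  unfold cycWeight
  refine sum_eq_zero fun τ _ => sum_eq_zero fun c _ => if_neg ?_
  simp [rot]

theorem cycWeight_univ (hκ : ∀ a b, A a → ¬ A b → κ b < κ a) : cycWeight σ κ A D univ = 0 := by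
  unfold cycWeight
  refine sum_eq_zero fun τ _ => sum_eq_zero fun c _ => ?_
  split_ifs with h1 h2
  · exfalso
    have h3 : ∀ p : Fin n, p ≠ 0 → p ∈ keyDes σ κ τ := by
      intro p hp
      have : p + c ∈ rot c (insert 0 (keyDes σ κ τ)) := h1 ▸ mem_univ _
      rw [mem_rot, add_sub_cancel_right, mem_insert] at this
      exact this.resolve_left hp
    have hT : IsTransition A (fun x => τ x - 0) := by simpa using h2.1
    rw [isTransition_equiv_iff] at hT
    have h4 : ∀ (k : ℕ) (hk : k < n), ¬ A (τ.symm ⟨k, hk⟩) := by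
      intro k
      induction k with
      | zero => exact fun _ => hT.1
      | succ k ih =>
        intro hk hA
        have hne : (⟨k + 1, hk⟩ : Fin n) ≠ 0 := fun h => by simpa using congrArg Fin.val h
        have hk' : (⟨k + 1, hk⟩ - 1 : Fin n) = ⟨k, by omega⟩ := by
          ext
          rw [Fin.val_sub_one_of_ne hne]
          simp
        have h5 := h3 _ hne
        simp only [keyDes, mem_filter, mem_univ, true_and, hk'] at h5
        have h6 := hκ _ _ hA (ih (by omega))
        rcases Prod.Lex.toLex_lt_toLex.1 h5.2 with h7 | h7
        · exact lt_asymm h6 h7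
        · exact h6.ne' h7.1
    exact h4 _ _ hT.2
  · rfl
  · rfl

theorem transCount_equiv_eq (hκ : ∀ a b, A a → ¬ A b → κ b < κ a) {I : Finset (Fin n)}
    (h0 : 0 ∈ I) {τ : Ω ≃ Fin n}
    (h : Compat σ (pairLabel (fun x => blockStart I (τ x)) κ) τ) :
    transCount A τ = transCount A (fun x => blockStart I (τ x)) := by
  classical
  exact congrArg card (filter_congr fun c _ => (isTransition_blockStart_iff hκ h0 h c).symm)

open scoped Classical in
theorem sum_cycWeight (hn : Nat.card Ω = n) (hκ : ∀ a b, A a → ¬ A b → κ b < κ a) {a₀ b₀ : Ω}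
    (ha : A a₀) (hb : ¬ A b₀)
    (hD : ∀ (f : Ω → Fin n) (τ : Ω ≃ Fin n), Compat σ (pairLabel f κ) τ → (D τ ↔ D f))
    (Ψ : Fin n → Equiv.Perm (Ω → Fin n))
    (hΨe : ∀ c f, ∃ e : Equiv.Perm Ω, (∀ x, A (e x) ↔ A x) ∧ ∀ x, Ψ c f (e x) = f x)
    (hΨN : ∀ c f, sortCount n σ (pairLabel (Ψ c f) κ) = sortCount n σ (pairLabel f κ))
    (hΨD : ∀ c f, D (fun x => f x - c) ↔ D (Ψ c f)) {I : Finset (Fin n)} (h0 : 0 ∈ I) :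
    ∑ J ∈ I.powerset, cycWeight σ κ A D J = ∑ f : Ω → Fin n,
      if SameContent f (blockStart I) ∧ D f then (sortCount n σ (pairLabel f κ) : ℚ) else 0 := by
  have hΨT : ∀ c f d, IsTransition A (fun x => Ψ c f x - d) ↔
      IsTransition A (fun x => f x - d) := fun c f d => by
    obtain ⟨e, he, hf⟩ := hΨe c f
    exact isTransition_comp_equiv e he fun x => by rw [hf]
  have hΨS : ∀ c f, SameContent (Ψ c f) (blockStart I) ↔ SameContent f (blockStart I) := by
    intro c f
    obtain ⟨e, he, hf⟩ := hΨe c f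
    have : SameContent f (Ψ c f) := by simpa [hf] using sameContent_comp_equiv (Ψ c f) e
    exact ⟨fun h => this.trans h, fun h => this.symm.trans h⟩
  have hΨC : ∀ c f, transCount A (Ψ c f) = transCount A f := fun c f => by
    unfold transCount
    simp only [hΨT]
  set w : (Ω → Fin n) → ℚ := fun f =>
    if IsTransition A f ∧ D f then (transCount A f : ℚ)⁻¹ else 0 with hw
  set N : (Ω → Fin n) → ℚ := fun f => (sortCount n σ (pairLabel f κ) : ℚ) with hN
  have step1 : ∑ J ∈ I.powerset, cycWeight σ κ A D J = ∑ c : Fin n, if c ∈ I then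
      ∑ τ : Ω ≃ Fin n, (if keyDes σ κ τ ⊆ rot (-c) I then w τ else 0) else 0 := by
    unfold cycWeight
    rw [sum_comm, sum_congr rfl fun τ _ => sum_comm, sum_comm]
    refine sum_congr rfl fun c _ => ?_
    trans ∑ τ : Ω ≃ Fin n, if c ∈ I then (if keyDes σ κ τ ⊆ rot (-c) I then w τ else 0) else 0
    swap
    · by_cases hc : c ∈ I <;> simp [hc]
    refine sum_congr rfl fun τ _ => ?_
    rw [sum_ite_eq]
    have : rot c (insert 0 (keyDes σ κ τ)) ∈ I.powerset ↔ c ∈ I ∧ keyDes σ κ τ ⊆ rot (-c) I := by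
      rw [mem_powerset, rot_subset_iff, insert_subset_iff, mem_rot]
      simp
    simp only [this, ite_and, hw]
  have step2 : ∀ c ∈ I, ∑ τ : Ω ≃ Fin n, (if keyDes σ κ τ ⊆ rot (-c) I then w τ else 0) =
      ∑ f : Ω → Fin n, if SameContent f (blockStart I) then
        w (fun x => f x - c) * N f else 0 := by
    intro c hc
    have h0' : (0 : Fin n) ∈ rot (-c) I := by simpa [mem_rot] using hc
    rw [sum_keyDes_subset σ κ h0' (fun τ => w τ) w]
    · rw [← Equiv.sum_comp (Equiv.subRight (fun _ => c))]
      refine sum_congr rfl fun f _ => ?_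
      have h1 : Equiv.subRight (fun _ => c) f = fun x => f x - c := rfl
      rw [h1]
      simp only [SameContent.sub_iff h0 hc, sortCount_sub hn, hN]
    · intro f τ hf hc'
      obtain rfl := hc'.eq_blockStart hf
      have h1 := isTransition_blockStart_iff hκ h0' hc' 0
      simp only [sub_zero] at h1
      simp only [hw, transCount_equiv_eq hκ h0' hc', hD _ _ hc', h1]
  have step3 : ∀ c, (if c ∈ I then
      ∑ τ : Ω ≃ Fin n, (if keyDes σ κ τ ⊆ rot (-c) I then w τ else 0) else 0) =
      ∑ f : Ω → Fin n, if SameContent f (blockStart I) ∧ D f then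
        (if IsTransition A (fun x => f x - c) then (transCount A f : ℚ)⁻¹ else 0) * N f
          else 0 := by
    intro c
    have h1 : (if c ∈ I then
        ∑ τ : Ω ≃ Fin n, (if keyDes σ κ τ ⊆ rot (-c) I then w τ else 0) else 0) =
        ∑ f : Ω → Fin n, if SameContent f (blockStart I) then
        w (fun x => f x - c) * N f else 0 := by
      by_cases hc : c ∈ I
      · rw [if_pos hc, step2 c hc]
      · rw [if_neg hc]
        refine (sum_eq_zero fun f _ => ?_).symm
        split_ifs with hf
        · have : ¬ IsTransition A (fun x => f x - c) := by
            rintro ⟨⟨b, _, hbc⟩, _⟩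
            rw [sub_eq_zero] at hbc
            obtain ⟨e, he⟩ := exists_equiv_of_card_fiber _ _ hf
            apply hc
            rw [← hbc, ← he]
            exact blockStart_mem h0 _
          simp [hw, this]
        · rfl
    rw [h1, ← Equiv.sum_comp (Ψ c) (fun f => if SameContent f (blockStart I) ∧ D f then _ else _)]
    refine sum_congr rfl fun f _ => ?_
    simp only [hΨS, hΨT, hΨC, ← hΨD, hN, hΨN, hw, transCount_sub]
    by_cases h2 : SameContent f (blockStart I) <;> by_cases h3 : D (fun x => f x - c) <;>
      simp [h2, h3]
  rw [step1, sum_congr rfl fun c _ => step3 c, sum_comm]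
  refine sum_congr rfl fun f _ => ?_
  split_ifs with h
  · rw [← sum_mul, ← sum_filter, sum_const, nsmul_eq_mul]
    have h1 : (transCount A f : ℚ) ≠ 0 := by
      obtain ⟨c, hc⟩ := exists_isTransition ha hb f
      have : 0 < transCount A f := card_pos.2 ⟨c, by simpa using hc⟩
      positivity
    change (transCount A f : ℚ) * _ * _ = _
    rw [mul_inv_cancel₀ h1, one_mul]
  · simp

end Weight

section Labels

variable {n : ℕ} [NeZero n]

/-- The element of `{1, …, n}` representing a residue modulo `n`. -/
def posLabel (i : Fin n) : ℕ := if i = 0 then n else i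

theorem posLabel_mod (i : Fin n) : posLabel i % n = i := by
  unfold posLabel
  split_ifs with h
  · simp [h]
  · exact Nat.mod_eq_of_lt i.2

theorem posLabel_injective : Function.Injective (posLabel (n := n)) := fun i j h => by
  apply Fin.ext
  rw [← posLabel_mod i, ← posLabel_mod j, h]

theorem posLabel_mem_Icc (i : Fin n) : posLabel i ∈ Icc 1 n := by
  have := i.2
  unfold posLabel
  rw [mem_Icc]
  split_ifs with h
  · omega
  · have : (i : ℕ) ≠ 0 := fun h' => h (Fin.ext (by simpa using h'))
    omega

theorem exists_posLabel_eq {k : ℕ} (hk : k ∈ Icc 1 n) : ∃ i : Fin n, posLabel i = k := by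
  rw [mem_Icc] at hk
  by_cases h : k = n
  · exact ⟨0, by simp [posLabel, h]⟩
  · refine ⟨⟨k, by omega⟩, if_neg fun h' => ?_⟩
    have := congrArg Fin.val h'
    simp at this
    omega

theorem posLabel_add_one (i : Fin n) : posLabel (i + 1) = i + 1 := by
  have := i.2
  have h1 : ((i + 1 : Fin n) : ℕ) = (i + 1) % n := by
    rw [Fin.val_add, Fin.val_one', Nat.add_mod_mod]
  unfold posLabel
  split_ifs with h
  · rw [h] at h1
    by_contra h2
    rw [Nat.mod_eq_of_lt (by omega)] at h1
    simp at h1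
  · rw [h1]
    refine Nat.mod_eq_of_lt (lt_of_le_of_ne this fun h2 => h (Fin.ext ?_))
    rw [h1, show (i : ℕ) + 1 = n from h2]
    simp

theorem posLabel_mem_Icc_pred (i : Fin n) : posLabel i ∈ Icc 1 (n - 1) ↔ i ≠ 0 := by
  have := i.2
  unfold posLabel
  rw [mem_Icc]
  split_ifs with h
  · simp only [h, ne_eq, not_true, iff_false]
    omega
  · have : (i : ℕ) ≠ 0 := fun h' => h (Fin.ext (by simpa using h'))
    simp only [ne_eq, h, not_false_iff, iff_true]
    omega

theorem hasCyclicExtension_iff {T : Type*} (DesT : T → Finset ℕ)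
    (hDes : ∀ t, DesT t ⊆ Icc 1 (n - 1)) :
    HasCyclicExtension n DesT ↔ ∃ (cD : T → Finset (Fin n)) (p : T ≃ T), ∀ t,
      (∀ i, i ≠ 0 → (i ∈ cD t ↔ posLabel i ∈ DesT t)) ∧ cD (p t) = rot 1 (cD t) ∧
        cD t ≠ ∅ ∧ cD t ≠ univ := by
  constructor
  · rintro ⟨cDes, p, h⟩
    refine ⟨fun t => univ.filter fun i => posLabel i ∈ cDes t, p, fun t => ?_⟩
    obtain ⟨h1, h2, h3, h4, h5⟩ := h t
    refine ⟨fun i hi => ?_, ?_, ?_, ?_⟩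
    · rw [← h2, mem_inter, posLabel_mem_Icc_pred]
      simp [hi]
    · ext i
      obtain ⟨j, rfl⟩ : ∃ j, i = j + 1 := ⟨i - 1, by simp⟩
      rw [mem_rot]
      simp only [h3, mem_filter, mem_univ, true_and, add_sub_cancel_right, sh, mem_image,
        posLabel_add_one, add_left_inj]
      constructor
      · rintro ⟨k, hk, hk'⟩
        obtain ⟨i, rfl⟩ := exists_posLabel_eq (h1 hk)
        rw [posLabel_mod] at hk'
        rwa [← Fin.ext hk']
      · exact fun hj => ⟨_, hj, posLabel_mod j⟩
    · obtain ⟨k, hk⟩ := nonempty_iff_ne_empty.2 h4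
      obtain ⟨i, rfl⟩ := exists_posLabel_eq (h1 hk)
      exact ne_empty_of_mem (a := i) (by simpa using hk)
    · intro hu
      refine h5 (Subset.antisymm h1 fun k hk => ?_)
      obtain ⟨i, rfl⟩ := exists_posLabel_eq hk
      beta_reduce at hu
      have : i ∈ univ.filter fun i => posLabel i ∈ cDes t := by
        rw [hu]
        exact mem_univ i
      simpa using this
  · rintro ⟨cD, p, h⟩
    refine ⟨fun t => (cD t).image posLabel, p, fun t => ?_⟩
    obtain ⟨h2, h3, h4, h5⟩ := h t
    refine ⟨?_, ?_, ?_, ?_, ?_⟩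
    · exact image_subset_iff.2 fun i _ => posLabel_mem_Icc i
    · ext k
      constructor
      · intro hk
        rw [mem_inter, mem_image] at hk
        obtain ⟨⟨i, hi, rfl⟩, hk⟩ := hk
        exact (h2 i ((posLabel_mem_Icc_pred i).1 hk)).1 hi
      · intro hk
        have hk' := hDes t hk
        obtain ⟨i, rfl⟩ := exists_posLabel_eq (n := n) (k := k) (by
          rw [mem_Icc] at hk' ⊢; omega)
        have hi := (posLabel_mem_Icc_pred i).1 hk'
        exact mem_inter.2 ⟨mem_image_of_mem _ ((h2 i hi).2 hk), hk'⟩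
    · beta_reduce
      rw [h3]
      ext k
      simp only [sh, mem_image, mem_rot]
      constructor
      · rintro ⟨i, hi, rfl⟩
        refine ⟨posLabel (i - 1), ⟨_, hi, rfl⟩, ?_⟩
        rw [posLabel_mod, ← posLabel_add_one, sub_add_cancel]
      · rintro ⟨_, ⟨i, hi, rfl⟩, rfl⟩
        exact ⟨i + 1, by simpa using hi, by rw [posLabel_mod, posLabel_add_one]⟩
    · simpa using h4
    · intro hu
      beta_reduce at hu
      refine h5 (eq_univ_of_forall fun i => ?_)
      have : posLabel i ∈ (cD t).image posLabel := hu ▸ posLabel_mem_Icc i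
      exact (posLabel_injective.mem_finset_image).1 this

end Labels

section ExtensionFromWeights

variable {n : ℕ} [NeZero n] {T : Type*} [Fintype T] {d : T → Finset (Fin n)}
  {m : Finset (Fin n) → ℚ} {c : ℚ}

theorem weight_add_insert (hd : ∀ t, 0 ∉ d t)
    (hm : ∀ I, 0 ∈ I → ∑ J ∈ I.powerset, m J = c * #{t | d t ⊆ I}) (J : Finset (Fin n))
    (hJ : 0 ∉ J) : m J + m (insert 0 J) = c * #{t | d t = J} := by
  induction J using Finset.strongInduction with
  | H J ih =>
    have h1 := hm (insert 0 J) (mem_insert_self _ _)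
    rw [sum_powerset_insert hJ, ← sum_add_distrib] at h1
    have h2 : (#{t | d t ⊆ insert 0 J} : ℚ) = ∑ K ∈ J.powerset, (#{t | d t = K} : ℚ) := by
      rw [← Nat.cast_sum, card_eq_sum_card_fiberwise (f := d) (t := J.powerset)]
      · refine congrArg _ (sum_congr rfl fun K hK => ?_)
        rw [filter_filter]
        congr 1
        ext t
        simp only [mem_filter, mem_univ, true_and, and_iff_right_iff_imp]
        rintro rfl
        exact (mem_powerset.1 hK).trans (subset_insert _ _)
      · intro t ht
        simp only [coe_filter, mem_univ, true_and, Set.mem_ofPred_eq] at ht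
        rw [mem_coe, mem_powerset]
        exact (subset_insert_iff_of_notMem (hd t)).1 ht
    rw [h2, mul_sum, ← add_sum_erase _ _ (mem_powerset_self J),
      ← add_sum_erase _ (fun K => c * (#{t | d t = K} : ℚ)) (mem_powerset_self J)] at h1
    have h3 : ∑ K ∈ J.powerset.erase J, (m K + m (insert 0 K)) =
        ∑ K ∈ J.powerset.erase J, c * (#{t | d t = K} : ℚ) := by
      refine sum_congr rfl fun K hK => ?_
      rw [mem_erase, mem_powerset] at hK
      exact ih K (hK.2.ssubset_of_ne hK.1) fun h => hJ (hK.2 h)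
    linarith

theorem weight_integral (hd : ∀ t, 0 ∉ d t) (hc : 0 < c) (hm0 : ∀ J, 0 ≤ m J) (hme : m ∅ = 0)
    (hmr : ∀ b J, m (rot b J) = m J)
    (hm : ∀ I, 0 ∈ I → ∑ J ∈ I.powerset, m J = c * #{t | d t ⊆ I}) (J : Finset (Fin n)) :
    ∃ k : ℕ, m J = c * k := by
  have key : ∀ (N : ℕ) (J : Finset (Fin n)), #J = N → ∃ k : ℤ, m J = c * k := by
    intro N
    induction N with
    | zero =>
      intro J hJ
      rw [card_eq_zero] at hJ
      exact ⟨0, by simp [hJ, hme]⟩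
    | succ N ih =>
      have h1 : ∀ J : Finset (Fin n), 0 ∈ J → #J = N + 1 → ∃ k : ℤ, m J = c * k := by
        intro J h0 hJ
        obtain ⟨k, hk⟩ := ih (J.erase 0) (by rw [card_erase_of_mem h0, hJ]; simp)
        have := weight_add_insert hd hm (J.erase 0) (notMem_erase _ _)
        rw [insert_erase h0, hk] at this
        refine ⟨(#{t | d t = J.erase 0} : ℤ) - k, ?_⟩
        push_cast
        linarith
      intro J hJ
      obtain ⟨j, hj⟩ := card_pos.1 (by omega : 0 < #J)
      obtain ⟨k, hk⟩ := h1 (rot (-j) J) (by simpa [mem_rot] using hj) (by simp [rot, hJ])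
      exact ⟨k, by rw [← hk, hmr]⟩
  obtain ⟨k, hk⟩ := key _ J rfl
  have h1 := hm0 J
  have h2 : 0 ≤ k := by
    rw [hk] at h1
    exact_mod_cast nonneg_of_mul_nonneg_right h1 hc
  lift k to ℕ using h2
  exact ⟨k, by simpa using hk⟩

theorem exists_cyclicExtension_of_weight (hd : ∀ t, 0 ∉ d t) (hc : 0 < c) (hm0 : ∀ J, 0 ≤ m J)
    (hme : m ∅ = 0) (hmu : m univ = 0) (hmr : ∀ b J, m (rot b J) = m J)
    (hm : ∀ I, 0 ∈ I → ∑ J ∈ I.powerset, m J = c * #{t | d t ⊆ I}) :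
    ∃ (cD : T → Finset (Fin n)) (p : T ≃ T), ∀ t,
      (cD t).erase 0 = d t ∧ cD (p t) = rot 1 (cD t) ∧ cD t ≠ ∅ ∧ cD t ≠ univ := by
  classical
  choose k hk using weight_integral hd hc hm0 hme hmr hm
  have hinj : ∀ {a b : ℕ}, c * (a : ℚ) = c * b → a = b := fun h => by
    exact_mod_cast mul_left_cancel₀ hc.ne' h
  have hk0 : ∀ J, m J = 0 → k J = 0 := fun J h => hinj (by rw [← hk, h]; simp)
  have hkr : ∀ b J, k (rot b J) = k J := fun b J => hinj (by rw [← hk, ← hk, hmr])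
  have hks : ∀ J, 0 ∉ J → k J + k (insert 0 J) = #{t | d t = J} := fun J hJ => hinj (by
    rw [← weight_add_insert hd hm J hJ, hk, hk]; push_cast; ring)
  have hsub : ∀ J : Finset (Fin n), ∃ S : Finset T, 0 ∉ J →
      S ⊆ ({t | d t = J} : Finset T) ∧ #S = k (insert 0 J) := by
    intro J
    by_cases hJ : 0 ∈ J
    · exact ⟨∅, fun h => absurd hJ h⟩
    · obtain ⟨S, hS⟩ := exists_subset_card_eq (s := ({t | d t = J} : Finset T))
        (n := k (insert 0 J)) (by rw [← hks J hJ]; omega)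
      exact ⟨S, fun _ => hS⟩
  choose S hS using hsub
  let cD : T → Finset (Fin n) := fun t => if t ∈ S (d t) then insert 0 (d t) else d t
  have hcD : ∀ t, (cD t).erase 0 = d t := by
    intro t
    simp only [cD]
    split_ifs
    · exact erase_insert (hd t)
    · exact erase_eq_of_notMem (hd t)
  have hfib0 : ∀ J, 0 ∈ J → #{t | cD t = J} = k J := by
    intro J hJ
    rw [← insert_erase hJ, ← (hS (J.erase 0) (notMem_erase _ _)).2, insert_erase hJ]
    congr 1
    ext t
    simp only [mem_filter, mem_univ, true_and]
    constructor
    · intro h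
      have h1 : d t = J.erase 0 := by rw [← hcD, h]
      rw [← h1]
      by_contra h2
      simp only [cD, h2, if_false] at h
      exact hd t (h ▸ hJ)
    · intro h
      have h1 : d t = J.erase 0 := by
        simpa using (hS (J.erase 0) (notMem_erase _ _)).1 h
      simp only [cD, h1, h, if_true, insert_erase hJ]
  have hfib : ∀ J, #{t | cD t = J} = k J := by
    intro J
    by_cases hJ : 0 ∈ J
    · exact hfib0 J hJ
    · have h1 : ({t | d t = J} : Finset T) =
          ({t | cD t = J} : Finset T) ∪ ({t | cD t = insert 0 J} : Finset T) := by
        ext t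
        simp only [mem_filter, mem_univ, true_and, mem_union]
        constructor
        · rintro rfl
          by_cases h : t ∈ S (d t) <;> simp [cD, h]
        · rintro (h | h)
          · rw [← hcD, h, erase_eq_of_notMem hJ]
          · rw [← hcD, h, erase_insert hJ]
      have h2 := hks J hJ
      rw [h1, card_union_of_disjoint, hfib0 _ (mem_insert_self _ _)] at h2
      · omega
      · rw [disjoint_filter]
        intro t _ h h'
        rw [h] at h'
        exact hJ (h' ▸ mem_insert_self _ _)
  obtain ⟨p, hp⟩ := exists_equiv_of_card_fiber (fun t => rot 1 (cD t)) cD (fun J => by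
    have h1 : ∀ t, rot 1 (cD t) = J ↔ cD t = rot (-1) J := by
      intro t
      constructor
      · rintro rfl
        rw [rot_rot]
        simp [rot_zero]
      · intro h
        rw [h, rot_rot]
        simp [rot_zero]
    simp only [h1]
    rw [Nat.card_eq_fintype_card, Nat.card_eq_fintype_card, Fintype.card_subtype,
      Fintype.card_subtype, hfib, hfib, hkr])
  refine ⟨cD, p, fun t => ⟨hcD t, hp t, fun h => ?_, fun h => ?_⟩⟩
  · have h1 := hfib ∅
    rw [hk0 _ hme, card_eq_zero] at h1
    exact absurd (h1 ▸ mem_filter.2 ⟨mem_univ t, h⟩) (notMem_empty t)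
  · have h1 := hfib univ
    rw [hk0 _ hmu, card_eq_zero] at h1
    exact absurd (h1 ▸ mem_filter.2 ⟨mem_univ t, h⟩) (notMem_empty t)

end ExtensionFromWeights

section ConjugacyClass

variable {n : ℕ} [NeZero n]

/-- The descents of `π`, as elements of `Fin n` at which a descent ends. -/
def finDes (π : Equiv.Perm (Fin n)) : Finset (Fin n) :=
  univ.filter fun i => i ≠ 0 ∧ π i < π (i - 1)

theorem Des_subset_Icc {n : ℕ} (π : Equiv.Perm (Fin n)) : Des π ⊆ Icc 1 (n - 1) :=
  filter_subset _ _

theorem posLabel_mem_Des {π : Equiv.Perm (Fin n)} {i : Fin n} (hi : i ≠ 0) :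
    posLabel i ∈ Des π ↔ i ∈ finDes π := by
  have h1 : posLabel i = i := if_neg hi
  have h2 := (posLabel_mem_Icc_pred i).2 hi
  have hv := Fin.val_sub_one_of_ne hi
  rw [h1] at h2
  simp only [Des, finDes, mem_filter, mem_univ, true_and, h1, h2, hi, ne_eq, not_false_iff]
  have h3 : (⟨(i : ℕ) - 1, by omega⟩ : Fin n) = i - 1 := Fin.ext (by simp [hv])
  have h4 : (i : ℕ) + 1 - 1 < n := by simp
  have h5 : (i : ℕ) - 1 < n := by omega
  have h6 : (⟨(i : ℕ) + 1 - 1, h4⟩ : Fin n) = i := Fin.ext (by simp)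
  rw [oneline, oneline, dif_pos h4, dif_pos h5, h3, h6, Fin.lt_def]
  omega

theorem zero_notMem_finDes (π : Equiv.Perm (Fin n)) : 0 ∉ finDes π := by simp [finDes]

theorem keyDes_unit {Ω : Type*} (σ : Equiv.Perm Ω) (τ : Ω ≃ Fin n) :
    keyDes σ (fun _ => ()) τ = finDes (τ.permCongr σ) := by
  ext i
  rw [keyDes, finDes, mem_filter, mem_filter]
  simp [sortKey, Prod.Lex.toLex_lt_toLex]

theorem fullCycleType_eq_parts {n : ℕ} (π : Equiv.Perm (Fin n)) :
    fullCycleType π = π.partition.parts := by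
  rw [Equiv.Perm.parts_partition, fullCycleType, Fintype.card_fin]

theorem isConj_of_fullCycleType_eq {n : ℕ} {π ρ : Equiv.Perm (Fin n)}
    (h : fullCycleType π = fullCycleType ρ) : IsConj π ρ := by
  rw [fullCycleType_eq_parts, fullCycleType_eq_parts] at h
  exact Equiv.Perm.partition_eq_of_isConj.2 (Nat.Partition.ext h)

theorem fullCycleType_eq_of_isConj {n : ℕ} {π ρ : Equiv.Perm (Fin n)}
    (h : IsConj π ρ) : fullCycleType π = fullCycleType ρ := by
  rw [fullCycleType_eq_parts, fullCycleType_eq_parts, Equiv.Perm.partition_eq_of_isConj.1 h]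

theorem permCongr_trans {n : ℕ} {Ω : Type*} {σ : Equiv.Perm Ω} {τ : Ω ≃ Fin n}
    {ρ : Equiv.Perm (Fin n)} :
    (τ.trans ρ).permCongr σ = ρ * τ.permCongr σ * ρ⁻¹ := by
  ext x
  simp [Equiv.Perm.mul_apply]

open scoped Classical in
theorem exists_sum_permCongr {Ω : Type*} [Fintype Ω] (σ : Equiv.Perm Ω) (τ₁ : Ω ≃ Fin n)
    (P : Multiset ℕ) (hP : fullCycleType (τ₁.permCongr σ) = P) :
    ∃ Z : ℕ, 0 < Z ∧ ∀ F : Equiv.Perm (Fin n) → ℚ, ∑ τ : Ω ≃ Fin n, F (τ.permCongr σ) =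
      Z * ∑ t : {π : Equiv.Perm (Fin n) // fullCycleType π = P}, F t.1 := by
  have hconj : ∀ τ : Ω ≃ Fin n, fullCycleType (τ.permCongr σ) = P := by
    intro τ
    rw [← hP]
    apply fullCycleType_eq_of_isConj
    rw [isConj_comm, isConj_iff]
    refine ⟨τ₁.symm.trans τ, ?_⟩
    rw [← permCongr_trans]
    congr 1
    ext x
    simp
  refine ⟨#{τ : Ω ≃ Fin n | τ.permCongr σ = τ₁.permCongr σ}, ?_, fun F => ?_⟩
  · exact card_pos.2 ⟨τ₁, by simp⟩
  rw [← sum_fiberwise (g := fun τ : Ω ≃ Fin n =>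
    (⟨τ.permCongr σ, hconj τ⟩ : {π // fullCycleType π = P})), mul_sum]
  refine sum_congr rfl fun t _ => ?_
  have h1 : IsConj (τ₁.permCongr σ) t.1 := isConj_of_fullCycleType_eq (by rw [hP, t.2])
  obtain ⟨ρ, hρ⟩ := isConj_iff.1 h1
  rw [← nsmul_eq_mul, ← sum_const]
  refine sum_bij' (fun τ _ => τ.trans ρ.symm) (fun τ _ => τ.trans ρ) ?_ ?_ ?_ ?_ ?_
  · intro τ hτ
    simp only [mem_filter, mem_univ, true_and, Subtype.ext_iff] at hτ ⊢
    rw [permCongr_trans, hτ, ← hρ]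
    change ρ⁻¹ * _ * ρ⁻¹⁻¹ = _
    group
  · intro τ hτ
    simp only [mem_filter, mem_univ, true_and, Subtype.ext_iff] at hτ ⊢
    rw [permCongr_trans, hτ, hρ]
  · intro τ _
    ext x
    simp
  · intro τ _
    ext x
    simp
  · intro τ hτ
    simp only [mem_filter, mem_univ, true_and, Subtype.ext_iff] at hτ
    rw [hτ]

open scoped Classical in
theorem exists_sum_sortCount {Ω : Type*} [Fintype Ω] (hn : Nat.card Ω = n) (σ : Equiv.Perm Ω)
    (τ₁ : Ω ≃ Fin n) (P : Multiset ℕ) (hP : fullCycleType (τ₁.permCongr σ) = P) :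
    ∃ Z : ℚ, 0 < Z ∧ ∀ I : Finset (Fin n), 0 ∈ I →
      ∑ f : Ω → Fin n, (if SameContent f (blockStart I) then (sortCount n σ f : ℚ) else 0) =
      Z * #{t : {π : Equiv.Perm (Fin n) // fullCycleType π = P} | finDes t.1 ⊆ I} := by
  obtain ⟨Z, hZ, h⟩ := exists_sum_permCongr σ τ₁ P hP
  refine ⟨Z, by exact_mod_cast hZ, fun I h0 => ?_⟩
  have h1 := sum_keyDes_subset σ (fun _ : Ω => ()) h0 (fun _ => 1) (fun _ => 1)
    fun _ _ _ _ => rfl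
  have h2 : ∀ f : Ω → Fin n, sortCount n σ (pairLabel f fun _ => ()) = sortCount n σ f :=
    fun f => sortCount_congr hn fun x y => by simp [pairLabel]
  simp only [keyDes_unit, one_mul, h2] at h1
  rw [← sum_boole, ← h fun π => if finDes π ⊆ I then 1 else 0, ← h1]

open scoped Classical in
/-- A cyclic extension exists when a refinement by `κ` and `D` counts proportionally. -/
theorem hasCyclicExtension_of_refinement {Ω K : Type*} [Fintype Ω] [LinearOrder K]
    (hn : Nat.card Ω = n) (σ : Equiv.Perm Ω) (τ₁ : Ω ≃ Fin n) (P : Multiset ℕ)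
    (hP : fullCycleType (τ₁.permCongr σ) = P) (κ : Ω → K) (A : Ω → Prop)
    (D : (Ω → Fin n) → Prop) (hκ : ∀ a b, A a → ¬ A b → κ b < κ a) {a₀ b₀ : Ω}
    (ha : A a₀) (hb : ¬ A b₀)
    (hD : ∀ (f : Ω → Fin n) (τ : Ω ≃ Fin n), Compat σ (pairLabel f κ) τ → (D τ ↔ D f))
    (Ψ : Fin n → Equiv.Perm (Ω → Fin n))
    (hΨe : ∀ c f, ∃ e : Equiv.Perm Ω, (∀ x, A (e x) ↔ A x) ∧ ∀ x, Ψ c f (e x) = f x)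
    (hΨN : ∀ c f, sortCount n σ (pairLabel (Ψ c f) κ) = sortCount n σ (pairLabel f κ))
    (hΨD : ∀ c f, D (fun x => f x - c) ↔ D (Ψ c f)) (c : ℚ) (hc : 0 < c)
    (hcount : ∀ I : Finset (Fin n), 0 ∈ I →
      ∑ f : Ω → Fin n, (if SameContent f (blockStart I) ∧ D f then
        (sortCount n σ (pairLabel f κ) : ℚ) else 0) =
      c * ∑ f : Ω → Fin n, if SameContent f (blockStart I) then (sortCount n σ f : ℚ) else 0) :
    HasCyclicExtension n
      (fun π : {π : Equiv.Perm (Fin n) // fullCycleType π = P} => Des π.1) := by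
  obtain ⟨Z, hZ, h⟩ := exists_sum_sortCount hn σ τ₁ P hP
  obtain ⟨cD, p, hcD⟩ := exists_cyclicExtension_of_weight
    (d := fun t : {π : Equiv.Perm (Fin n) // fullCycleType π = P} => finDes t.1)
    (m := cycWeight σ κ A D) (c := c * Z) (fun t => zero_notMem_finDes t.1) (by positivity)
    cycWeight_nonneg cycWeight_empty (cycWeight_univ hκ) cycWeight_rot (fun I h0 => by
      rw [sum_cycWeight hn hκ ha hb hD Ψ hΨe hΨN hΨD h0, hcount I h0, h I h0, mul_assoc])
  refine (hasCyclicExtension_iff _ fun t => Des_subset_Icc t.1).2 ⟨cD, p, fun t => ?_⟩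
  obtain ⟨h1, h2⟩ := hcD t
  refine ⟨fun i hi => ?_, h2⟩
  rw [posLabel_mem_Des hi, ← h1, mem_erase]
  simp [hi]

end ConjugacyClass

theorem minimalPeriod_apply_of_commute {Ω : Type*} {σ z : Equiv.Perm Ω}
    (h : ∀ x, z (σ x) = σ (z x)) (x : Ω) :
    Function.minimalPeriod σ (z x) = Function.minimalPeriod σ x := by
  rw [Function.minimalPeriod_eq_minimalPeriod_iff]
  intro m
  have h1 : ∀ m : ℕ, σ^[m] (z x) = z (σ^[m] x) := by
    intro m
    induction m with
    | zero => rfl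
    | succ m ih => rw [Function.iterate_succ_apply', Function.iterate_succ_apply', ih, h]
  unfold Function.IsPeriodicPt Function.IsFixedPt
  rw [h1, z.injective.eq_iff]

theorem hasCyclicExtension_of_minimalPeriod_ne {n : ℕ} [NeZero n] {P : Multiset ℕ}
    {σ : Equiv.Perm (Fin n)} (hσ : fullCycleType σ = P) {x₀ y₀ : Fin n}
    (hne : Function.minimalPeriod σ x₀ ≠ Function.minimalPeriod σ y₀) :
    HasCyclicExtension n
      (fun π : {π : Equiv.Perm (Fin n) // fullCycleType π = P} => Des π.1) := by
  classical
  let A : Fin n → Prop := fun x => Function.minimalPeriod σ x = Function.minimalPeriod σ x₀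
  let κ : Fin n → ℕ := fun x => if A x then 1 else 0
  have hA : ∀ z : Equiv.Perm (Fin n), (∀ x, z (σ x) = σ (z x)) → ∀ x, κ (z x) = κ x := by
    intro z hz x
    simp only [κ, A, minimalPeriod_apply_of_commute hz]
  have hpow : ∀ (m : ℕ) x, κ ((σ ^ m) x) = κ x := fun m x =>
    hA (σ ^ m) (fun x => by rw [← Equiv.Perm.mul_apply, ← pow_succ, pow_succ',
      Equiv.Perm.mul_apply]) x
  have hn : Nat.card (Fin n) = n := Nat.card_fin n
  have hN : ∀ f : Fin n → Fin n, sortCount n σ (pairLabel f κ) = sortCount n σ f := by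
    intro f
    have h1 : IsPrim σ (pairLabel f κ) ↔ IsPrim σ f := by
      simp only [IsPrim, pairLabel, toLex_inj, Prod.mk.injEq, hpow, and_true]
    have h2 : Nat.card (CentStab σ (pairLabel f κ)) = Nat.card (CentStab σ f) := by
      refine Nat.card_congr (Equiv.subtypeEquivRight fun z => and_congr_right fun hz => ?_)
      simp only [pairLabel, toLex_inj, Prod.mk.injEq, hA z hz, and_true]
    rw [sortCount, sortCount, card_compat _ _ hn, card_compat _ _ hn, h2]
    simp only [h1]
  refine hasCyclicExtension_of_refinement hn σ (Equiv.refl _) P hσ κ A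
    (fun _ => True) (fun a b ha hb => by simp [κ, ha, hb]) (a₀ := x₀) (b₀ := y₀) rfl hne.symm
    (fun _ _ _ => Iff.rfl) (fun _ => Equiv.refl _)
    (fun _ f => ⟨Equiv.refl _, fun _ => Iff.rfl, fun _ => rfl⟩) (fun _ _ => rfl)
    (fun _ _ => Iff.rfl) 1 one_pos fun I _ => ?_
  simp only [hN, and_true, one_mul]

section Rows

variable {s r : ℕ} [NeZero r]

/-- The permutation of `Fin s × ZMod r` rotating each row by one. -/
def rowShift (s r : ℕ) : Equiv.Perm (Fin s × ZMod r) :=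
  Equiv.prodCongr (Equiv.refl _) (Equiv.addRight 1)

theorem rowShift_apply {s r : ℕ} (p : Fin s × ZMod r) : rowShift s r p = (p.1, p.2 + 1) := rfl

theorem rowShift_pow_apply {s r : ℕ} (m : ℕ) (p : Fin s × ZMod r) :
    (rowShift s r ^ m) p = (p.1, p.2 + m) := by
  induction m with
  | zero => simp
  | succ m ih =>
    rw [pow_succ', Equiv.Perm.mul_apply, ih, rowShift_apply]
    simp [add_assoc]

/-- A cyclic word without nontrivial rotational symmetry. -/
def PrimWord {X : Type*} (w : ZMod r → X) : Prop := ∀ t, (∀ j, w (j + t) = w j) → t = 0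

theorem isPrim_rowShift_iff {X : Type*} {f : Fin s × ZMod r → X} :
    IsPrim (rowShift s r) f ↔ ∀ i, PrimWord fun j => f (i, j) := by
  constructor
  · intro h i t ht
    obtain ⟨m, rfl⟩ := ZMod.natCast_zmod_surjective t
    have := h (i, 0) m fun j => by
      simp only [rowShift_pow_apply]
      rw [add_right_comm]
      exact ht _
    simpa [rowShift_pow_apply] using this
  · rintro h ⟨i, j⟩ m hm
    have := h i m fun k => by
      obtain ⟨l, hl⟩ := ZMod.natCast_zmod_surjective (k - j)
      have := hm l
      simp only [rowShift_pow_apply, hl] at this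
      rw [show j + m + (k - j) = k + m by ring, show j + (k - j) = k by ring] at this
      exact this
    simp [rowShift_pow_apply, this]

variable {S L : Type*} {G : S → ZMod r → L}

theorem isPrim_of_rows (hG : ∀ x y t, (∀ j, G x (j + t) = G y j) → x = y ∧ t = 0)
    (x : Fin s → S) (c : Fin s → ZMod r) :
    IsPrim (rowShift s r) fun p => G (x p.1) (p.2 + c p.1) := by
  rw [isPrim_rowShift_iff]
  intro i t ht
  refine (hG (x i) (x i) t fun j => ?_).2
  have := ht (j - c i)
  simp only at this
  rwa [sub_add_cancel, show j - c i + t + c i = j + t by ring] at this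

theorem card_centStab_rows (hG : ∀ x y t, (∀ j, G x (j + t) = G y j) → x = y ∧ t = 0)
    (x : Fin s → S) (c : Fin s → ZMod r) :
    Nat.card (CentStab (rowShift s r) fun p => G (x p.1) (p.2 + c p.1)) =
      Nat.card {ρ : Equiv.Perm (Fin s) // ∀ i, x (ρ i) = x i} := by
  symm
  let φ : Equiv.Perm (Fin s) → Equiv.Perm (Fin s × ZMod r) := fun ρ =>
    { toFun := fun p => (ρ p.1, p.2 + c p.1 - c (ρ p.1))
      invFun := fun p => (ρ.symm p.1, p.2 + c p.1 - c (ρ.symm p.1))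
      left_inv := fun p => by ext <;> simp
      right_inv := fun p => by ext <;> simp }
  refine Nat.card_congr (Equiv.ofBijective (fun ρ => ⟨φ ρ.1, fun p => ?_, fun p => ?_⟩) ⟨?_, ?_⟩)
  · simp only [rowShift_apply, φ, Equiv.coe_fn_mk, Prod.mk.injEq, true_and]
    ring
  · simp [φ, ρ.2]
  · rintro ⟨ρ, hρ⟩ ⟨ρ', hρ'⟩ h
    apply Subtype.ext
    ext i
    have := congrArg (fun z => (z.1 (i, 0)).1) h
    simp only [φ, Equiv.coe_fn_mk] at this
    rw [this]
  · rintro ⟨z, hz, hgz⟩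
    have hz' : ∀ i j, z (i, j) = ((z (i, 0)).1, j + (z (i, 0)).2) := by
      have : ∀ i (m : ℕ), z (i, (m : ZMod r)) = ((z (i, 0)).1, m + (z (i, 0)).2) := by
        intro i m
        induction m with
        | zero => simp
        | succ m ih =>
          have := hz (i, (m : ZMod r))
          rw [ih] at this
          simp only [rowShift_apply] at this
          rw [Nat.cast_succ, this]
          ext <;> simp
          ring
      intro i j
      obtain ⟨m, rfl⟩ := ZMod.natCast_zmod_surjective j
      exact this i m
    have hx : ∀ i, x (z (i, 0)).1 = x i ∧ (z (i, 0)).2 + c (z (i, 0)).1 - c i = 0 := by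
      intro i
      refine hG _ _ _ fun j => ?_
      have := hgz (i, j - c i)
      rw [hz'] at this
      simp only [sub_add_cancel] at this
      rw [← this]
      congr 1
      ring
    have hinj : Function.Injective fun i => (z (i, 0)).1 := by
      intro i i' h
      simp only at h
      have : z (i, 0) = z (i', (z (i, 0)).2 - (z (i', 0)).2) := by
        rw [hz' i' (_ - _), ← h, sub_add_cancel]
      exact congrArg Prod.fst (z.injective this)
    refine ⟨⟨Equiv.ofBijective _ (Finite.injective_iff_bijective.1 hinj), fun i => (hx i).1⟩, ?_⟩
    apply Subtype.ext
    refine Equiv.ext ?_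
    rintro ⟨i, j⟩
    rw [hz' i j]
    simp only [φ, Equiv.coe_fn_mk, Equiv.ofBijective_apply, Prod.mk.injEq, true_and]
    linear_combination -(hx i).2

open scoped Classical in
theorem sum_isPrim_rows [Fintype S] [Fintype L]
    (hG : ∀ x y t, (∀ j, G x (j + t) = G y j) → x = y ∧ t = 0)
    (hsurj : ∀ w : ZMod r → L, PrimWord w → ∃ y c, ∀ j, w j = G y (j + c))
    (F : (Fin s × ZMod r → L) → ℚ)
    (hF : ∀ (x : Fin s → S) (c : Fin s → ZMod r), F (fun p => G (x p.1) (p.2 + c p.1)) =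
      F fun p => G (x p.1) p.2) :
    ∑ f : Fin s × ZMod r → L, F f * (if IsPrim (rowShift s r) f then
      (Nat.card (CentStab (rowShift s r) f) : ℚ) else 0) =
    r ^ s * ∑ x : Fin s → S, F (fun p => G (x p.1) p.2) *
      (Nat.card {ρ : Equiv.Perm (Fin s) // ∀ i, x (ρ i) = x i} : ℚ) := by
  let g : (Fin s → S) × (Fin s → ZMod r) → (Fin s × ZMod r → L) := fun q p =>
    G (q.1 p.1) (p.2 + q.2 p.1)
  have hinj : Function.Injective g := by
    rintro ⟨x, c⟩ ⟨x', c'⟩ h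
    have : ∀ i, x i = x' i ∧ c i - c' i = 0 := fun i => hG _ _ _ fun j => by
      have := congrFun h (i, j - c' i)
      simp only [g, sub_add_cancel] at this
      rw [← this]
      congr 1
      ring
    refine Prod.ext (funext fun i => (this i).1) (funext fun i => sub_eq_zero.1 (this i).2)
  rw [← Finset.sum_of_injOn (s := univ) (t := univ) g
    (f := fun q => F (fun p => G (q.1 p.1) p.2) *
      (Nat.card {ρ : Equiv.Perm (Fin s) // ∀ i, q.1 (ρ i) = q.1 i} : ℚ)) hinj.injOn
    (fun _ _ => by simp)]
  · rw [Fintype.sum_prod_type]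
    simp only [sum_const, nsmul_eq_mul, card_univ, Fintype.card_pi, ZMod.card, prod_const,
      Fintype.card_fin, mul_sum]
    push_cast
    rfl
  · intro f _ hf
    rw [if_neg, mul_zero]
    intro hprim
    rw [isPrim_rowShift_iff] at hprim
    choose x c hxc using fun i => hsurj _ (hprim i)
    exact hf ⟨(x, c), by simp, funext fun p => (hxc p.1 p.2).symm⟩
  · rintro ⟨x, c⟩ _
    rw [if_pos (isPrim_of_rows hG x c), card_centStab_rows hG, hF]

end Rows

section Necklaces

variable {r : ℕ} [NeZero r] {X : Type*}

/-- Primitive cyclic words up to rotation. -/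
def neckSetoid (r : ℕ) [NeZero r] (X : Type*) : Setoid {w : ZMod r → X // PrimWord w} where
  r w v := ∃ t, ∀ j, w.1 j = v.1 (j + t)
  iseqv :=
    { refl := fun w => ⟨0, by simp⟩
      symm := fun {w v} ⟨t, ht⟩ => ⟨-t, fun j => by simp [ht]⟩
      trans := fun {w v u} ⟨t, ht⟩ ⟨t', ht'⟩ => ⟨t + t', fun j => by rw [ht, ht', add_assoc]⟩ }

/-- Primitive necklaces. -/
abbrev Neck (r : ℕ) [NeZero r] (X : Type*) : Type _ := Quotient (neckSetoid r X)

/-- A representative word of a necklace. -/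
noncomputable def Neck.word (y : Neck r X) : ZMod r → X := y.out.1

theorem Neck.word_rigid (x y : Neck r X) (t : ZMod r) (h : ∀ j, x.word (j + t) = y.word j) :
    x = y ∧ t = 0 := by
  have h1 : x = y := by
    rw [← Quotient.out_eq x, ← Quotient.out_eq y]
    exact Quotient.sound ⟨-t, fun j => by
      have := h (j - t)
      rw [sub_add_cancel] at this
      rw [← sub_eq_add_neg]
      exact this⟩
  subst h1
  exact ⟨rfl, x.out.2 t h⟩

theorem Neck.exists_word (w : ZMod r → X) (hw : PrimWord w) :
    ∃ (y : Neck r X) (c : ZMod r), ∀ j, w j = y.word (j + c) := by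
  obtain ⟨t, ht⟩ := Quotient.exact (Quotient.out_eq (Quotient.mk (neckSetoid r X) ⟨w, hw⟩))
  exact ⟨Quotient.mk _ ⟨w, hw⟩, -t, fun j => by simp [Neck.word, ht]⟩

theorem Neck.primWord (y : Neck r X) (c : ZMod r) : PrimWord fun j => y.word (j + c) := by
  intro t ht
  refine (Neck.word_rigid y y t fun j => ?_).2
  have := ht (j - c)
  simp only at this
  rwa [sub_add_cancel, show j - c + t + c = j + t by ring] at this

/-- Primitive words are necklaces with a starting point. -/
noncomputable def Neck.prodEquiv (r : ℕ) [NeZero r] (X : Type*) :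
    Neck r X × ZMod r ≃ {w : ZMod r → X // PrimWord w} :=
  Equiv.ofBijective (fun p => ⟨fun j => p.1.word (j + p.2), Neck.primWord p.1 p.2⟩) ⟨by
    rintro ⟨x, c⟩ ⟨y, d⟩ h
    have h1 : x = y ∧ c - d = 0 := Neck.word_rigid _ _ _ fun j => by
      have := congrFun (congrArg Subtype.val h) (j - d)
      simp only [sub_add_cancel] at this
      rw [← this]
      congr 1
      ring
    exact Prod.ext h1.1 (sub_eq_zero.1 h1.2), by
    rintro ⟨w, hw⟩
    obtain ⟨y, c, h⟩ := Neck.exists_word w hw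
    exact ⟨(y, c), Subtype.ext (funext fun j => (h j).symm)⟩⟩

end Necklaces

section Inversions

variable {X : Type*} [LinearOrder X]

/-- Number of inversions of a word. -/
def invCount {m : ℕ} (w : Fin m → X) : ℕ :=
  ∑ i, #{j | i < j ∧ w j < w i}

/-- Number of occurrences of each letter. -/
def content {J : Type*} [Fintype J] (w : J → X) (x : X) : ℕ := #{i | w i = x}

theorem invCount_cons {m : ℕ} (x : X) (v : Fin m → X) :
    invCount (Fin.cons x v : Fin (m + 1) → X) = #{j | v j < x} + invCount v := by
  unfold invCount
  rw [Fin.sum_univ_succ]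
  congr 1
  · simp only [card_filter, Fin.sum_univ_succ]
    simp
  · refine sum_congr rfl fun i _ => ?_
    simp only [card_filter, Fin.sum_univ_succ]
    simp

theorem content_cons {m : ℕ} (x : X) (v : Fin m → X) :
    content (Fin.cons x v : Fin (m + 1) → X) = content v + Pi.single x 1 := by
  ext y
  simp only [content, card_filter, Fin.sum_univ_succ, Pi.add_apply, Pi.single_apply,
    Fin.cons_zero, Fin.cons_succ, eq_comm (a := y)]
  rw [add_comm]

variable [Fintype X]

theorem sum_content {J : Type*} [Fintype J] (w : J → X) : ∑ x, content w x = Fintype.card J := by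
  simp only [content]
  rw [← card_eq_sum_card_fiberwise (f := w) (t := univ) (fun _ _ => mem_coe.2 (mem_univ _)),
    card_univ]

theorem card_lt_eq_sum_content {J : Type*} [Fintype J] (w : J → X) (x : X) :
    #{j | w j < x} = ∑ y with y < x, content w y := by
  rw [card_eq_sum_card_fiberwise (f := w) (t := univ.filter (· < x)) (fun j hj => by
    simpa using hj)]
  refine sum_congr rfl fun y hy => ?_
  rw [content, filter_filter]
  congr 1
  refine filter_congr fun j _ => ?_
  simp only [mem_filter, mem_univ, true_and] at hy
  exact ⟨fun h => h.2, fun h => ⟨h ▸ hy, h⟩⟩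

variable {R : Type*} [CommRing R]

/-- The `q`-analogue of a natural number. -/
def qNum (q : R) (k : ℕ) : R := ∑ i ∈ range k, q ^ i

/-- The `q`-factorial. -/
def qFact (q : R) (k : ℕ) : R := ∏ i ∈ range k, qNum q (i + 1)

theorem qNum_add (q : R) (k l : ℕ) : qNum q (k + l) = qNum q k + q ^ k * qNum q l := by
  simp only [qNum, sum_range_add, pow_add, mul_sum]

theorem qFact_eq_mul (q : R) {k : ℕ} (hk : k ≠ 0) :
    qFact q k = qNum q k * qFact q (k - 1) := by
  obtain ⟨k, rfl⟩ := Nat.exists_eq_succ_of_ne_zero hk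
  simp [qFact, prod_range_succ, mul_comm]

theorem sum_pow_mul_qNum (q : R) (α : X → ℕ) (s : Finset X) (hs : ∀ x ∈ s, ∀ y < x, y ∈ s) :
    ∑ x ∈ s, q ^ (∑ y with y < x, α y) * qNum q (α x) = qNum q (∑ x ∈ s, α x) := by
  induction s using Finset.induction_on_max with
  | empty => simp [qNum]
  | insert a s hmax ih =>
    have ha : a ∉ s := fun h => lt_irrefl _ (hmax a h)
    have h1 : univ.filter (· < a) = s := by
      ext y
      simp only [mem_filter, mem_univ, true_and]
      refine ⟨fun h => ?_, hmax y⟩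
      exact (mem_insert.1 (hs a (mem_insert_self _ _) y h)).resolve_left h.ne
    rw [sum_insert ha, sum_insert ha, ih fun x hx y hy => ?_, h1, add_comm (α a), qNum_add,
      add_comm]
    exact (mem_insert.1 (hs x (mem_insert_of_mem hx) y hy)).resolve_left
      (hy.trans (hmax x hx)).ne

theorem sum_content_eq_pow_invCount (q : R) (m : ℕ) (α : X → ℕ) (hα : ∑ x, α x = m) :
    (∑ w : Fin m → X, if content w = α then q ^ invCount w else 0) * ∏ x, qFact q (α x) =
      qFact q m := by
  induction m generalizing α with
  | zero =>
    have h0 : α = 0 := by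
      ext x
      exact (sum_eq_zero_iff.1 hα) x (mem_univ x)
    subst h0
    have h1 : ∀ w : Fin 0 → X, content w = 0 := fun w => by
      ext x
      simp [content]
    simp [h1, invCount, qFact]
  | succ m ih =>
    rw [← (Fin.consEquiv fun _ : Fin (m + 1) => X).sum_comp, Fintype.sum_prod_type, sum_mul]
    have key : ∀ x : X, (∑ v : Fin m → X,
        if content (Fin.cons x v : Fin (m + 1) → X) = α then
          q ^ invCount (Fin.cons x v : Fin (m + 1) → X) else 0) * ∏ x, qFact q (α x) =
        q ^ (∑ y with y < x, α y) * qNum q (α x) * qFact q m := by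
      intro x
      rcases Nat.eq_zero_or_pos (α x) with hx | hx
      · have : ∀ v : Fin m → X, content (Fin.cons x v : Fin (m + 1) → X) ≠ α := fun v h => by
          rw [content_cons] at h
          have := congrFun h x
          simp [hx] at this
        simp [this, hx, qNum]
      · have hsplit : α = (α - Pi.single x 1) + Pi.single x 1 := by
          ext y
          by_cases hy : y = x
          · subst hy
            simp only [Pi.add_apply, Pi.sub_apply, Pi.single_eq_same]
            omega
          · simp [hy]
        have hm : ∑ y, (α - Pi.single x 1 : X → ℕ) y = m := by
          have : ∑ y, ((α - Pi.single x 1 : X → ℕ) + (Pi.single x 1 : X → ℕ)) y = m + 1 := by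
            rw [← hsplit, hα]
          simpa [sum_add_distrib] using this
        have h1 : ∀ v : Fin m → X, (content (Fin.cons x v : Fin (m + 1) → X) = α ↔
            content v = α - Pi.single x 1) := fun v => by
          rw [content_cons]
          constructor
          · rintro rfl
            exact (add_tsub_cancel_right _ _).symm
          · intro h
            rw [h]
            exact hsplit.symm
        have h2 : ∀ v : Fin m → X, (if content (Fin.cons x v : Fin (m + 1) → X) = α then
            q ^ invCount (Fin.cons x v : Fin (m + 1) → X) else 0) =
            q ^ (∑ y with y < x, α y) *
              if content v = α - Pi.single x 1 then q ^ invCount v else 0 := fun v => by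
          by_cases hv : content v = α - Pi.single x 1
          · rw [if_pos ((h1 v).2 hv), if_pos hv, invCount_cons, card_lt_eq_sum_content, hv, pow_add]
            congr 2
            refine sum_congr rfl fun y hy => ?_
            simp only [mem_filter, mem_univ, true_and] at hy
            simp [hy.ne]
          · rw [if_neg (fun h => hv ((h1 v).1 h)), if_neg hv, mul_zero]
        have h3 : ∏ y, qFact q (α y) = qNum q (α x) *
            ∏ y, qFact q ((α - Pi.single x 1 : X → ℕ) y) := by
          rw [← mul_prod_erase _ _ (mem_univ x), ← mul_prod_erase univ _ (mem_univ x),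
            qFact_eq_mul q hx.ne', mul_assoc]
          congr 2
          · simp
          · refine prod_congr rfl fun y hy => ?_
            simp [ne_of_mem_erase hy]
        rw [sum_congr rfl fun v _ => h2 v, ← mul_sum, h3, ← ih _ hm]
        ring
    refine (sum_congr rfl fun x _ => key x).trans ?_
    rw [← sum_mul, sum_pow_mul_qNum q α univ (fun _ _ _ _ => mem_univ _), hα,
      qFact_eq_mul q m.succ_ne_zero]
    rfl

theorem qFact_X_ne_zero (k : ℕ) : qFact (Polynomial.X : Polynomial ℤ) k ≠ 0 := by
  refine prod_ne_zero_iff.2 fun i _ h => ?_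
  have := congrArg (Polynomial.eval 1) h
  simp [qNum, Polynomial.eval_finsetSum] at this
  omega

end Inversions

section Rotation

variable {n : ℕ} [NeZero n] {m : ℕ}

theorem content_sub (w : Fin m → Fin n) (c : Fin n) (x : Fin n) :
    content (fun j => w j - c) x = content w (x + c) := by
  simp only [content, sub_eq_iff_eq_add]

theorem card_content_invCount_sub (c : Fin n) (α : Fin n → ℕ) (k : ℕ) :
    #{w : Fin m → Fin n | content w = α ∧ invCount (fun j => w j - c) = k} =
      #{w : Fin m → Fin n | content w = α ∧ invCount w = k} := by
  by_cases hα : ∑ x, α x = m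
  · have h1 := sum_content_eq_pow_invCount (Polynomial.X : Polynomial ℤ) m α hα
    have h2 := sum_content_eq_pow_invCount (Polynomial.X : Polynomial ℤ) m
      (fun x => α (x + c)) (by rw [← hα]; exact Equiv.sum_comp (Equiv.addRight c) α)
    have h3 : ∏ x, qFact (Polynomial.X : Polynomial ℤ) (α (x + c)) =
      ∏ x, qFact (Polynomial.X : Polynomial ℤ) (α x) :=
      Equiv.prod_comp (Equiv.addRight c) fun x => qFact (Polynomial.X : Polynomial ℤ) (α x)
    rw [h3, ← h1] at h2
    have h4 := mul_right_cancel₀ (prod_ne_zero_iff.2 fun x _ => qFact_X_ne_zero _) h2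
    rw [← (Equiv.piCongrRight fun _ : Fin m => Equiv.subRight c).sum_comp] at h4
    have h5 := congrArg (fun p => p.coeff k) h4
    have h6 : ∀ w : Fin m → Fin n, (content (fun j => w j - c) = (fun x => α (x + c)) ↔
        content w = α) := fun w => by
      rw [funext_iff, funext_iff]
      simp only [content_sub]
      exact (Equiv.addRight c).forall_congr_right (q := fun x => content w x = α x)
    simp only [Polynomial.finsetSum_coeff] at h5
    change ∑ w : Fin m → Fin n, (if content (fun j => w j - c) = (fun x => α (x + c)) then
        (Polynomial.X : Polynomial ℤ) ^ invCount (fun j => w j - c) else 0).coeff k = _ at h5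
    simp only [h6] at h5
    have h7 : ∀ (p : Prop) [Decidable p] (i : ℕ),
        (if p then (Polynomial.X : Polynomial ℤ) ^ i else 0).coeff k =
          if p ∧ i = k then 1 else 0 := fun p _ i => by
      by_cases hp : p <;> simp [hp, Polynomial.coeff_X_pow, eq_comm]
    simp only [h7, sum_boole] at h5
    exact_mod_cast h5
  · have : ∀ w : Fin m → Fin n, content w ≠ α := fun w h => hα (by
      rw [← h, sum_content, Fintype.card_fin])
    simp [this]

/-- Rotating the alphabet can be compensated by a content-preserving bijection of words. -/
theorem exists_equiv_content_invCount (m : ℕ) (c : Fin n) :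
    ∃ ψ : (Fin m → Fin n) ≃ (Fin m → Fin n), ∀ w, content (ψ w) = content w ∧
      invCount (ψ w) = invCount fun j => w j - c := by
  obtain ⟨ψ, hψ⟩ := exists_equiv_of_card_fiber
    (fun w : Fin m → Fin n => (content w, invCount fun j => w j - c))
    (fun w : Fin m → Fin n => (content w, invCount w)) fun p => by
      simp only [Nat.card_eq_fintype_card, Fintype.card_subtype, Prod.ext_iff]
      exact card_content_invCount_sub c p.1 p.2
  exact ⟨ψ, fun w => ⟨congrArg Prod.fst (hψ w), congrArg Prod.snd (hψ w)⟩⟩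

end Rotation

section RootsOfUnity

variable {X : Type*} [LinearOrder X]

theorem qNum_ne_zero {K : Type*} [Field K] {ζ : K} {d : ℕ} (hζ : IsPrimitiveRoot ζ d) {k : ℕ}
    (h0 : k ≠ 0) (hk : k < d) : qNum ζ k ≠ 0 := by
  intro h
  have h1 := geom_sum_mul ζ k
  rw [show ∑ i ∈ range k, ζ ^ i = 0 from h, zero_mul] at h1
  exact hζ.pow_ne_one_of_pos_of_lt h0 hk (sub_eq_zero.1 h1.symm)

theorem content_eq_card_iff {J : Type*} [Fintype J] {w : J → X} {x : X} :
    content w x = Fintype.card J ↔ ∀ j, w j = x := by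
  rw [content, ← card_univ, card_filter_eq_iff]
  simp

theorem invCount_append {a b : ℕ} (u : Fin a → X) (v : Fin b → X) :
    invCount (Fin.append u v) = invCount u + invCount v + ∑ i, #{j | v j < u i} := by
  unfold invCount
  simp only [card_filter, Fin.sum_univ_add, Fin.append_left, Fin.append_right]
  have h1 : ∀ (i : Fin a) (j : Fin b), Fin.castAdd b i < Fin.natAdd a j := fun i j => by
    simp only [Fin.lt_def, Fin.val_castAdd, Fin.val_natAdd]; omega
  simp only [h1, (h1 _ _).not_gt, true_and, false_and, if_false, sum_const_zero, zero_add,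
    sum_add_distrib, (Fin.strictMono_castAdd b).lt_iff_lt, (Fin.strictMono_natAdd a).lt_iff_lt]
  ring

variable [Fintype X]

theorem prod_apply_eq_prod_pow_content {A J : Type*} [CommRing A] [Fintype J] (y : X → A)
    (w : J → X) : ∏ j, y (w j) = ∏ x, y x ^ content w x := by
  rw [← prod_fiberwise univ w]
  refine prod_congr rfl fun x _ => ?_
  rw [prod_congr rfl fun j hj => by rw [(mem_filter.1 hj).2], prod_const]
  rfl

variable {A : Type*} [CommRing A]

theorem sum_pow_invCount_of_isPrimitiveRoot {K : Type*} [Field K] [Algebra K A] {ζ : K} {d : ℕ}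
    (hd : d ≠ 0) (hζ : IsPrimitiveRoot ζ d) (y : X → A) :
    ∑ u : Fin d → X, algebraMap K A ζ ^ invCount u * ∏ j, y (u j) = ∑ x, y x ^ d := by
  have h1 : ∑ u : Fin d → X, algebraMap K A ζ ^ invCount u * ∏ j, y (u j) =
      ∑ u : Fin d → X, if ∃ x, content u x = d then
        algebraMap K A ζ ^ invCount u * ∏ j, y (u j) else 0 := by
    rw [← sum_fiberwise_of_maps_to (s := univ) (t := univ.image content)
        (g := (content : (Fin d → X) → X → ℕ)) (fun u hu => mem_image_of_mem _ hu),
      ← sum_fiberwise_of_maps_to (s := univ) (t := univ.image content)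
        (g := (content : (Fin d → X) → X → ℕ)) (fun u hu => mem_image_of_mem _ hu)]
    refine sum_congr rfl fun α hα => ?_
    obtain ⟨u₀, -, hu₀⟩ := mem_image.1 hα
    have hsum : ∑ x, α x = d := by rw [← hu₀, sum_content, Fintype.card_fin]
    by_cases hx : ∃ x, α x = d
    · refine sum_congr rfl fun u hu => ?_
      rw [if_pos]
      rwa [(mem_filter.1 hu).2]
    · rw [sum_congr rfl fun u hu => by rw [prod_apply_eq_prod_pow_content, (mem_filter.1 hu).2],
        ← sum_mul]
      have hr : ∑ u : Fin d → X with content u = α, (if ∃ x, content u x = d then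
          algebraMap K A ζ ^ invCount u * ∏ j, y (u j) else 0) = 0 :=
        sum_eq_zero fun u hu => if_neg (by rwa [(mem_filter.1 hu).2])
      rw [hr]
      have hlt : ∀ x, α x < d := fun x => by
        refine lt_of_le_of_ne (hsum ▸ single_le_sum (fun _ _ => Nat.zero_le _) (mem_univ x))
          fun h => hx ⟨x, h⟩
      have hd1 : 1 < d := by
        by_contra hd1
        have h0 : ∀ x, α x = 0 := fun x => by have := hlt x; omega
        simp [h0] at hsum
        omega
      have h2 := sum_content_eq_pow_invCount ζ d α hsum
      have h3 : qFact ζ d = 0 := by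
        rw [qFact_eq_mul ζ hd, show qNum ζ d = 0 from hζ.geom_sum_eq_zero hd1, zero_mul]
      rw [h3, mul_eq_zero] at h2
      have h4 := h2.resolve_right (prod_ne_zero_iff.2 fun x _ => prod_ne_zero_iff.2 fun i hi =>
        qNum_ne_zero hζ i.succ_ne_zero (by have := hlt x; have := mem_range.1 hi; omega))
      rw [← sum_filter] at h4
      have h5 := congrArg (algebraMap K A) h4
      rw [map_sum, map_zero] at h5
      simp only [map_pow] at h5
      rw [h5, zero_mul]
  rw [h1, ← sum_filter]
  have h2 : univ.filter (fun u : Fin d → X => ∃ x, content u x = d) =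
      univ.image fun x _ => x := by
    ext u
    simp only [mem_filter, mem_univ, true_and, mem_image]
    refine exists_congr fun x => ?_
    have := content_eq_card_iff (w := u) (x := x)
    rw [Fintype.card_fin] at this
    rw [this, funext_iff]
    exact forall_congr' fun j => eq_comm
  rw [h2, sum_image fun x _ x' _ h => congrFun h (⟨0, Nat.pos_of_ne_zero hd⟩ : Fin d)]
  refine sum_congr rfl fun x _ => ?_
  simp [invCount]

theorem sum_pow_invCount_mul {K : Type*} [Field K] [Algebra K A] {ζ : K} {d : ℕ}
    (hd : d ≠ 0) (hζ : IsPrimitiveRoot ζ d) (y : X → A) (k m : ℕ) (hm : m = k * d) :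
    ∑ u : Fin m → X, algebraMap K A ζ ^ invCount u * ∏ j, y (u j) = (∑ x, y x ^ d) ^ k := by
  induction k generalizing m with
  | zero =>
    rw [zero_mul] at hm
    subst hm
    simp [invCount]
  | succ k ih =>
    obtain rfl : m = d + k * d := by rw [hm]; ring
    rw [← (Fin.appendEquiv d (k * d) (α := X)).sum_comp, Fintype.sum_prod_type_right]
    have key : ∀ v : Fin (k * d) → X, ∑ u : Fin d → X,
        algebraMap K A ζ ^ invCount (Fin.append u v) * ∏ j, y (Fin.append u v j) =
        (∑ x, y x ^ d) * (algebraMap K A ζ ^ invCount v * ∏ j, y (v j)) := fun v => by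
      have h1 := sum_pow_invCount_of_isPrimitiveRoot hd hζ
        fun x => y x * algebraMap K A ζ ^ #{j | v j < x}
      have h2 : algebraMap K A ζ ^ d = 1 := by rw [← map_pow, hζ.pow_eq_one, map_one]
      simp only [mul_pow, ← pow_mul, mul_comm _ d] at h1
      simp only [pow_mul, h2, one_pow, mul_one] at h1
      rw [← h1, sum_mul]
      refine sum_congr rfl fun u _ => ?_
      rw [invCount_append, Fin.prod_univ_add, prod_mul_distrib, prod_pow_eq_pow_sum]
      simp only [Fin.append_left, Fin.append_right]
      ring
    refine (sum_congr rfl fun v _ => key v).trans ?_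
    rw [← mul_sum, ih _ rfl, pow_succ']

end RootsOfUnity

section Periodic

/-- Words on an abelian group invariant under a subgroup of translations. -/
theorem sum_periodic_words {G X A : Type*} [AddCommGroup G] [Fintype G]
    [DecidableEq G] [Fintype X] [CommRing A] (H : AddSubgroup G) (y : X → A)
    [DecidablePred fun w : G → X => ∀ h ∈ H, ∀ j, w (j + h) = w j] :
    ∑ w : G → X, (if ∀ h ∈ H, ∀ j, w (j + h) = w j then ∏ j, y (w j) else 0) =
      (∑ x, y x ^ Nat.card H) ^ Nat.card (G ⧸ H) := by
  classical
  have : Fintype (G ⧸ H) := Fintype.ofFinite _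
  rw [Nat.card_eq_fintype_card (α := G ⧸ H), ← card_univ, ← prod_const, prod_univ_sum,
    Fintype.piFinset_univ, ← sum_filter]
  symm
  refine sum_bij' (fun u _ j => u (QuotientAddGroup.mk j)) (fun w _ p => w p.out) ?_ ?_ ?_ ?_ ?_
  · intro u _
    simp only [mem_filter, mem_univ, true_and]
    intro h hh j
    congr 1
    exact QuotientAddGroup.mk_add_of_mem j hh
  · intro _ _
    exact mem_univ _
  · intro u _
    ext p
    simp
  · intro w hw
    ext j
    obtain ⟨⟨h, hh⟩, hj⟩ := QuotientAddGroup.mk_out_eq_add H j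
    beta_reduce
    rw [hj]
    exact (mem_filter.1 hw).2 h hh j
  · intro u _
    rw [← prod_fiberwise univ (QuotientAddGroup.mk : G → G ⧸ H)]
    refine prod_congr rfl fun p _ => ?_
    rw [prod_congr (g := fun _ => y (u p)) rfl fun j hj => by
      beta_reduce; rw [(mem_filter.1 hj).2], prod_const]
    congr 1
    obtain ⟨g, rfl⟩ := QuotientAddGroup.mk_surjective p
    rw [← Fintype.card_subtype, ← Nat.card_eq_fintype_card]
    exact Nat.card_congr
      { toFun := fun h => ⟨g + h, QuotientAddGroup.mk_add_of_mem g h.2⟩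
        invFun := fun i => ⟨-g + i, QuotientAddGroup.eq.1 i.2.symm⟩
        left_inv := fun h => by simp
        right_inv := fun i => by simp }

end Periodic

section PrimitiveCount

variable {e : ℕ} [NeZero e]

theorem isPrimitiveRoot_stdAddChar (a : ZMod e) :
    IsPrimitiveRoot (ZMod.stdAddChar a) (addOrderOf a) := by
  have h := orderOf_injective (ZMod.stdAddChar (N := e)).toMonoidHom
    (fun x y h => ZMod.injective_stdAddChar h) (Multiplicative.ofAdd a)
  rw [orderOf_ofAdd_eq_addOrderOf] at h
  rw [← h]
  exact IsPrimitiveRoot.orderOf _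

theorem sum_stdAddChar_mul_pow (N : ℕ) :
    ∑ a : ZMod e, ZMod.stdAddChar (-a) * ZMod.stdAddChar a ^ N =
      if (N : ZMod e) = 1 then (e : ℂ) else 0 := by
  have h := AddChar.sum_mulShift ((N : ZMod e) - 1) (ZMod.isPrimitive_stdAddChar e)
  rw [ZMod.card] at h
  simp only [sub_eq_zero, Nat.cast_ite, Nat.cast_zero] at h
  rw [← h]
  refine sum_congr rfl fun a _ => ?_
  rw [← AddChar.map_nsmul_eq_pow, ← AddChar.map_add_eq_mul]
  congr 1
  rw [nsmul_eq_mul]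
  ring

theorem sum_stdAddChar_subgroup (H : AddSubgroup (ZMod e)) [DecidablePred (· ∈ H)]
    [Decidable (∀ a ∈ H, a = 0)] :
    ∑ a : ZMod e, (if a ∈ H then ZMod.stdAddChar (-a) else 0) =
      if ∀ a ∈ H, a = 0 then (1 : ℂ) else 0 := by
  split_ifs with h
  · rw [sum_eq_single 0 (fun a _ ha => if_neg fun h' => ha (h a h'))
      (fun h => absurd (mem_univ _) h), if_pos H.zero_mem, neg_zero, AddChar.map_zero_eq_one]
  · push Not at h
    obtain ⟨a₀, ha₀, hne⟩ := h
    have h1 := Equiv.sum_comp (Equiv.addRight a₀)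
      fun a : ZMod e => if a ∈ H then (ZMod.stdAddChar (-a) : ℂ) else 0
    simp only [Equiv.coe_addRight, H.add_mem_cancel_right ha₀, neg_add, AddChar.map_add_eq_mul,
      ← ite_zero_mul, ← sum_mul] at h1
    have h2 : (ZMod.stdAddChar (-a₀) : ℂ) ≠ 1 := fun h => hne (by
      rw [← AddChar.map_zero_eq_one (ZMod.stdAddChar (N := e))] at h
      exact neg_eq_zero.1 (ZMod.injective_stdAddChar h))
    exact (mul_right_eq_self₀.1 h1).resolve_left h2

variable {q r : ℕ} [NeZero r]

/-- Multiplication by `q` as an embedding of `ZMod e` into `ZMod (q * e)`. -/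
noncomputable def mulEmbed (h : r = q * e) : ZMod e →+ ZMod r :=
  ZMod.lift e ⟨zmultiplesHom (ZMod r) (q : ZMod r), by
    rw [zmultiplesHom_apply, natCast_zsmul, nsmul_eq_mul, ← Nat.cast_mul, mul_comm, ← h,
      ZMod.natCast_self]⟩

theorem mulEmbed_natCast (h : r = q * e) (m : ℕ) : mulEmbed h (m : ZMod e) = (q * m : ℕ) := by
  have := ZMod.lift_coe e (A := ZMod r) ⟨zmultiplesHom (ZMod r) (q : ZMod r), by
    rw [zmultiplesHom_apply, natCast_zsmul, nsmul_eq_mul, ← Nat.cast_mul, mul_comm, ← h,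
      ZMod.natCast_self]⟩ (m : ℤ)
  rw [Int.cast_natCast] at this
  rw [mulEmbed, this]
  simp [mul_comm]

theorem mulEmbed_injective (h : r = q * e) : Function.Injective (mulEmbed h) := by
  rw [injective_iff_map_eq_zero]
  intro a ha
  obtain ⟨m, rfl⟩ := ZMod.natCast_zmod_surjective a
  rw [mulEmbed_natCast, ZMod.natCast_eq_zero_iff] at ha
  rw [ZMod.natCast_eq_zero_iff]
  have hq : 0 < q := Nat.pos_of_ne_zero fun hq => NeZero.ne r (by rw [h, hq, zero_mul])
  have h1 : q * e ∣ q * m := by rwa [← h]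
  exact Nat.dvd_of_mul_dvd_mul_left hq h1

variable {X : Type*}

/-- The translations fixing a cyclic word. -/
def wordStab (w : ZMod r → X) : AddSubgroup (ZMod r) where
  carrier := {t | ∀ j, w (j + t) = w j}
  zero_mem' := by simp
  add_mem' := fun {s t} hs ht j => by rw [← add_assoc, ht, hs]
  neg_mem' := fun {t} ht j => by rw [← ht (j + -t), neg_add_cancel_right]

theorem mem_wordStab {w : ZMod r → X} {t : ZMod r} : t ∈ wordStab w ↔ ∀ j, w (j + t) = w j :=
  Iff.rfl

theorem primWord_iff_mulEmbed (h : r = q * e) (hqe : q ∣ e) {w : ZMod r → X} :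
    PrimWord w ↔ ∀ a ∈ (wordStab w).comap (mulEmbed h), a = 0 := by
  constructor
  · intro hw a ha
    exact mulEmbed_injective h ((hw _ ha).trans (map_zero _).symm)
  · intro hw t ht
    obtain ⟨m, rfl⟩ := ZMod.natCast_zmod_surjective t
    have h1 : (m : ZMod e) = 0 := hw _ (by
      rw [AddSubgroup.mem_comap, mulEmbed_natCast, Nat.cast_mul, ← nsmul_eq_mul]
      exact AddSubgroup.nsmul_mem (wordStab w) ht q)
    rw [ZMod.natCast_eq_zero_iff] at h1
    obtain ⟨k, rfl⟩ := hqe.trans h1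
    have h2 : (k : ZMod e) = 0 := hw _ (by
      rw [AddSubgroup.mem_comap, mulEmbed_natCast]
      exact ht)
    rw [← mulEmbed_natCast h, h2, map_zero]

variable [LinearOrder X] [Fintype X] {A : Type*} [CommRing A] [Algebra ℂ A] [NeZero q]

open scoped Classical in
theorem sum_primWord_eq (h : r = q * e) (hqe : q ∣ e) (y : X → A) :
    ∑ w : ZMod r → X, (if PrimWord w then ∏ j, y (w j) else 0) =
      (e : A) * ∑ v : ZMod q → Fin e → X, if ((∑ i, invCount (v i) : ℕ) : ZMod e) = 1 then
        ∏ i, ∏ j, y (v i j) else 0 := by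
  set χ : ZMod e → A := fun a => algebraMap ℂ A (ZMod.stdAddChar a) with hχ
  have hL : ∑ w : ZMod r → X, (if PrimWord w then ∏ j, y (w j) else 0) =
      ∑ a : ZMod e, χ (-a) * ∑ w : ZMod r → X,
        if ∀ h' ∈ AddSubgroup.zmultiples (mulEmbed h a), ∀ j, w (j + h') = w j then
          ∏ j, y (w j) else 0 := by
    simp only [mul_sum]
    rw [sum_comm]
    refine sum_congr rfl fun w _ => ?_
    have h1 := congrArg (algebraMap ℂ A)
      (sum_stdAddChar_subgroup ((wordStab w).comap (mulEmbed h)))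
    simp only [← primWord_iff_mulEmbed h hqe, map_sum] at h1
    have h2 : ∀ a : ZMod e, (∀ h' ∈ AddSubgroup.zmultiples (mulEmbed h a), ∀ j, w (j + h') = w j) ↔
        a ∈ (wordStab w).comap (mulEmbed h) := fun a => by
      rw [AddSubgroup.mem_comap]
      exact AddSubgroup.zmultiples_le (H := wordStab w)
    simp only [h2]
    have h3 : ∀ (p : Prop) (c z : A), c * (if p then z else 0) = (if p then c else 0) * z := by
      intro p c z; by_cases hp : p <;> simp [hp]
    simp only [h3, ← sum_mul]
    have h4 : ∀ (p : Prop) (c : ℂ), algebraMap ℂ A (if p then c else 0) =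
        if p then algebraMap ℂ A c else 0 := by
      intro p c; by_cases hp : p <;> simp [hp]
    simp only [h4, map_one] at h1
    rw [h1]
    split_ifs <;> simp
  have hR : (e : A) * ∑ v : ZMod q → Fin e → X, (if ((∑ i, invCount (v i) : ℕ) : ZMod e) = 1 then
        ∏ i, ∏ j, y (v i j) else 0) =
      ∑ a : ZMod e, χ (-a) * (∑ u : Fin e → X, χ a ^ invCount u * ∏ j, y (u j)) ^ q := by
    have h1 : ∀ a : ZMod e, (∑ u : Fin e → X, χ a ^ invCount u * ∏ j, y (u j)) ^ q =
        ∑ v : ZMod q → Fin e → X, χ a ^ (∑ i, invCount (v i)) * ∏ i, ∏ j, y (v i j) := fun a => by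
      have hc : #(univ : Finset (ZMod q)) = q := by rw [card_univ, ZMod.card]
      conv_lhs => rw [← hc]
      rw [← prod_const, prod_univ_sum, Fintype.piFinset_univ]
      simp only [prod_mul_distrib, prod_pow_eq_pow_sum]
    simp only [h1, mul_sum]
    rw [sum_comm]
    refine sum_congr rfl fun v _ => ?_
    have h2 := congrArg (algebraMap ℂ A) (sum_stdAddChar_mul_pow (e := e) (∑ i, invCount (v i)))
    simp only [map_sum, map_mul, map_pow] at h2
    simp only [← mul_assoc, ← sum_mul]
    rw [h2]
    split_ifs <;> simp
  rw [hL, hR]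
  refine sum_congr rfl fun a _ => ?_
  congr 1
  rw [sum_periodic_words, Nat.card_zmultiples, addOrderOf_injective _ (mulEmbed_injective h)]
  obtain ⟨k, hk⟩ := addOrderOf_dvd_card (x := a)
  rw [ZMod.card] at hk
  have hpos : 0 < addOrderOf a := addOrderOf_pos a
  rw [sum_pow_invCount_mul hpos.ne' (isPrimitiveRoot_stdAddChar a) y k e (by rw [mul_comm, ← hk]),
    ← pow_mul]
  congr 1
  have h1 := AddSubgroup.card_eq_card_quotient_mul_card_addSubgroup
    (AddSubgroup.zmultiples (mulEmbed h a))
  rw [Nat.card_zmultiples, addOrderOf_injective _ (mulEmbed_injective h), Nat.card_eq_fintype_card,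
    ZMod.card] at h1
  apply Nat.eq_of_mul_eq_mul_right hpos
  rw [← h1, h]
  conv_lhs => rw [hk]
  ring

end PrimitiveCount

section Balanced

variable {q e r : ℕ} [NeZero q] [NeZero e] [NeZero r] {X : Type*} [LinearOrder X]

/-- Block words whose inversion numbers satisfy the two congruences. -/
def IsBalanced (v : ZMod q → Fin e → X) : Prop :=
  ((∑ i, invCount (v i) : ℕ) : ZMod e) = 1 ∧ ∑ i, i * (invCount (v i) : ZMod q) = 0

/-- Content of a block word. -/
def blockContent (v : ZMod q → Fin e → X) : X → ℕ :=
  content fun p : ZMod q × Fin e => v p.1 p.2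

theorem content_comp_equiv {J J' : Type*} [Fintype J] [Fintype J'] (w : J' → X) (g : J ≃ J') :
    content (fun j => w (g j)) = content w := by
  ext x
  simp only [content, ← Fintype.card_subtype]
  exact Fintype.card_congr (g.subtypeEquiv fun _ => Iff.rfl)

theorem blockContent_rotate (v : ZMod q → Fin e → X) (t : ZMod q) :
    blockContent (fun i => v (i + t)) = blockContent v :=
  content_comp_equiv (fun p : ZMod q × Fin e => v p.1 p.2)
    (Equiv.prodCongr (Equiv.addRight t) (Equiv.refl _))

variable [Fintype X]

theorem prod_X_eq_monomial {J : Type*} [Fintype J] (w : J → X) :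
    ∏ j, (MvPolynomial.X (w j) : MvPolynomial X ℂ) =
      MvPolynomial.monomial (Finsupp.equivFunOnFinite.symm (content w)) 1 := by
  rw [prod_apply_eq_prod_pow_content, MvPolynomial.monomial_eq, map_one, one_mul,
    Finsupp.prod_fintype _ _ fun _ => pow_zero _]
  rfl

open scoped Classical in
theorem card_primWord_content (h : r = q * e) (hqe : q ∣ e) (α : X → ℕ) :
    #{w : ZMod r → X | PrimWord w ∧ content w = α} =
      e * #{v : ZMod q → Fin e → X |
        ((∑ i, invCount (v i) : ℕ) : ZMod e) = 1 ∧ blockContent v = α} := by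
  have h1 := congrArg (MvPolynomial.coeff (Finsupp.equivFunOnFinite.symm α))
    (sum_primWord_eq h hqe (MvPolynomial.X : X → MvPolynomial X ℂ))
  have hprod : ∀ v : ZMod q → Fin e → X, ∏ i, ∏ j, (MvPolynomial.X (v i j) : MvPolynomial X ℂ) =
      MvPolynomial.monomial (Finsupp.equivFunOnFinite.symm (blockContent v)) 1 := fun v => by
    rw [blockContent, ← prod_X_eq_monomial]
    exact (Fintype.prod_prod_type (fun p : ZMod q × Fin e =>
      (MvPolynomial.X (v p.1 p.2) : MvPolynomial X ℂ))).symm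
  have hcoeff : ∀ (p : Prop) [Decidable p] (β : X → ℕ), MvPolynomial.coeff (Finsupp.equivFunOnFinite.symm α)
      (if p then MvPolynomial.monomial (Finsupp.equivFunOnFinite.symm β) (1 : ℂ) else 0) =
      if p ∧ β = α then 1 else 0 := fun p _ β => by
    by_cases hp : p <;> simp [hp, MvPolynomial.coeff_monomial]
  simp only [hprod] at h1
  simp only [prod_X_eq_monomial] at h1
  rw [← map_natCast (MvPolynomial.C (σ := X) (R := ℂ)), MvPolynomial.coeff_C_mul,
    MvPolynomial.coeff_sum, MvPolynomial.coeff_sum] at h1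
  simp only [hcoeff, sum_boole] at h1
  exact_mod_cast h1

open scoped Classical in
theorem card_isBalanced_content (hqe : q ∣ e) (α : X → ℕ) :
    #{v : ZMod q → Fin e → X | ((∑ i, invCount (v i) : ℕ) : ZMod e) = 1 ∧ blockContent v = α} =
      q * #{v : ZMod q → Fin e → X | IsBalanced v ∧ blockContent v = α} := by
  rw [card_eq_sum_card_fiberwise (t := univ)
    (f := fun v : ZMod q → Fin e → X => ∑ i, i * (invCount (v i) : ZMod q))
    fun _ _ => mem_coe.2 (mem_univ _)]
  have key : ∀ (v : ZMod q → Fin e → X) (t : ZMod q), ((∑ i, invCount (v i) : ℕ) : ZMod e) = 1 →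
      ((∑ i, invCount (v (i + t)) : ℕ) : ZMod e) = 1 ∧
      ∑ i, i * (invCount (v (i + t)) : ZMod q) = ∑ i, i * (invCount (v i) : ZMod q) - t := by
    intro v t hv
    have h1 : ∑ i, invCount (v (i + t)) = ∑ i, invCount (v i) :=
      Equiv.sum_comp (Equiv.addRight t) fun i => invCount (v i)
    have h2 : ∑ i, (i + t) * (invCount (v (i + t)) : ZMod q) =
        ∑ i, i * (invCount (v i) : ZMod q) :=
      Equiv.sum_comp (Equiv.addRight t) fun i => i * (invCount (v i) : ZMod q)
    have h3 : ((∑ i, invCount (v i) : ℕ) : ZMod q) = 1 := by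
      have := congrArg (ZMod.castHom hqe (ZMod q)) hv
      rwa [map_natCast, map_one] at this
    refine ⟨by rw [h1, hv], ?_⟩
    simp only [add_mul, sum_add_distrib, ← mul_sum] at h2
    rw [← Nat.cast_sum, h1, h3, mul_one] at h2
    rw [← h2, add_sub_cancel_right]
  rw [sum_const_nat (m := #{v : ZMod q → Fin e → X | IsBalanced v ∧ blockContent v = α}),
    card_univ, ZMod.card]
  intro t _
  refine card_bij' (fun v _ i => v (i + t)) (fun v _ i => v (i + -t)) ?_ ?_ ?_ ?_
  · intro v hv
    simp only [mem_filter, mem_univ, true_and] at hv ⊢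
    obtain ⟨h1, h2⟩ := key v t hv.1.1
    exact ⟨⟨h1, by rw [h2, hv.2, sub_self]⟩, by rw [blockContent_rotate, hv.1.2]⟩
  · intro v hv
    simp only [mem_filter, mem_univ, true_and] at hv ⊢
    obtain ⟨h1, h2⟩ := key v (-t) hv.1.1
    exact ⟨⟨h1, by rw [blockContent_rotate, hv.2]⟩, by rw [h2, hv.1.2, sub_neg_eq_add, zero_add]⟩
  · intro v _
    simp
  · intro v _
    simp

theorem exists_equiv_neck_isBalanced (h : r = q * e) (hqe : q ∣ e) :
    ∃ β : Neck r X ≃ {v : ZMod q → Fin e → X // IsBalanced v},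
      ∀ y, blockContent (β y).1 = content y.word := by
  classical
  have : Fintype (Neck r X) := Fintype.ofFinite _
  refine exists_equiv_of_card_fiber (fun y : Neck r X => content y.word)
    (fun v : {v : ZMod q → Fin e → X // IsBalanced v} => blockContent v.1) fun α => ?_
  apply Nat.eq_of_mul_eq_mul_left (Nat.pos_of_ne_zero (NeZero.ne r))
  have h1 := card_primWord_content (X := X) h hqe α
  rw [card_isBalanced_content hqe, ← mul_assoc, mul_comm e q, ← h] at h1
  rw [Nat.card_congr (Equiv.subtypeSubtypeEquivSubtypeInter (p := IsBalanced)
      (q := fun v : ZMod q → Fin e → X => blockContent v = α)),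
    Nat.card_eq_fintype_card (α := {x // _ ∧ _}), Fintype.card_subtype, ← h1,
    ← Fintype.card_subtype, ← Nat.card_eq_fintype_card,
    ← Nat.card_congr (Equiv.subtypeSubtypeEquivSubtypeInter (p := PrimWord)
      (q := fun w : ZMod r → X => content w = α)),
    ← Nat.card_congr ((Neck.prodEquiv r X).subtypeEquiv (p := fun p => content p.1.word = α)
      fun p => ?_)]
  · rw [Nat.card_congr (Equiv.prodSubtypeFstEquivSubtypeProd (p := fun y : Neck r X =>
      content y.word = α)), Nat.card_prod, mul_comm, Nat.card_zmod]
  · change _ ↔ content (fun j => p.1.word (j + p.2)) = α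
    rw [← content_comp_equiv p.1.word (Equiv.addRight p.2)]
    rfl

end Balanced

theorem invCount_congr {X Y : Type*} [LinearOrder X] [LinearOrder Y] {m : ℕ} {w : Fin m → X}
    {w' : Fin m → Y} (h : ∀ i j, i < j → (w j < w i ↔ w' j < w' i)) : invCount w = invCount w' := by
  unfold invCount
  refine sum_congr rfl fun i _ => congrArg card (filter_congr fun j _ => ?_)
  exact and_congr_right fun hij => h i j hij

theorem sameContent_of_content_eq {X J J' : Type*} [LinearOrder X] [Fintype J] [Fintype J']
    {f : J → X} {f' : J' → X} (h : content f = content f') : SameContent f f' := fun x => by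
  rw [Nat.card_eq_fintype_card, Nat.card_eq_fintype_card, Fintype.card_subtype,
    Fintype.card_subtype]
  exact congrFun h x

theorem content_prod {X I J : Type*} [LinearOrder X] [Fintype I] [Fintype J] (f : I × J → X) :
    content f = ∑ i, content fun j => f (i, j) := by
  ext x
  simp only [content, card_filter, Fintype.sum_prod_type, Finset.sum_apply]

section Squareful

variable {s q e r : ℕ} [NeZero q] [NeZero e] [NeZero r]

/-- Words on the rows, grouped into blocks. -/
def blockEquiv {X : Type*} (s : ℕ) (ε : ZMod r ≃ ZMod q × Fin e) :
    (Fin s × ZMod r → X) ≃ (Fin s × ZMod q → Fin e → X) :=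
  (Equiv.arrowCongr ((Equiv.prodCongr (Equiv.refl _) ε).trans (Equiv.prodAssoc _ _ _).symm)
    (Equiv.refl _)).trans (Equiv.curry _ _ _)

theorem blockEquiv_apply {X : Type*} (ε : ZMod r ≃ ZMod q × Fin e) (f : Fin s × ZMod r → X)
    (p : Fin s × ZMod q) (c : Fin e) : blockEquiv s ε f p c = f (p.1, ε.symm (p.2, c)) := rfl

theorem apply_eq_blockEquiv {X : Type*} (ε : ZMod r ≃ ZMod q × Fin e) (f : Fin s × ZMod r → X)
    (p : Fin s × ZMod r) : f p = blockEquiv s ε f (p.1, (ε p.2).1) (ε p.2).2 := by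
  rw [blockEquiv_apply]
  simp

theorem row_eq_iff_blockEquiv {X : Type*} (ε : ZMod r ≃ ZMod q × Fin e) (f : Fin s × ZMod r → X)
    (i i' : Fin s) : ((fun j => f (i, j)) = fun j => f (i', j)) ↔
      ∀ b, blockEquiv s ε f (i, b) = blockEquiv s ε f (i', b) := by
  constructor
  · intro h b
    ext c
    exact congrFun h _
  · intro h
    ext j
    rw [apply_eq_blockEquiv ε f (i, j), apply_eq_blockEquiv ε f (i', j)]
    exact congrFun (h _) _

theorem sortCount_pairLabel_rows {X K : Type*} [LinearOrder X] [LinearOrder K] {n : ℕ}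
    (hn : Nat.card (Fin s × ZMod r) = n) {κ : ZMod r → K} (hκ : Function.Injective κ)
    (f : Fin s × ZMod r → X) :
    sortCount n (rowShift s r) (pairLabel f fun p => κ p.2) =
      Nat.card {ρ : Equiv.Perm (Fin s) // ∀ i, (fun j => f (ρ i, j)) = fun j => f (i, j)} := by
  have hG : ∀ (x y : ZMod r → X) (t : ZMod r),
      (∀ j, toLex (x (j + t), κ (j + t)) = toLex (y j, κ j)) → x = y ∧ t = 0 := by
    intro x y t h
    have ht : t = 0 := by
      have := hκ (congrArg Prod.snd (toLex.injective (h 0)))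
      simpa using this
    subst ht
    refine ⟨funext fun j => ?_, rfl⟩
    have := congrArg Prod.fst (toLex.injective (h j))
    simpa using this
  have h1 := isPrim_of_rows (s := s) (G := fun (w : ZMod r → X) j => toLex (w j, κ j)) hG
    (fun i j => f (i, j)) 0
  have h2 := card_centStab_rows (s := s) (G := fun (w : ZMod r → X) j => toLex (w j, κ j)) hG
    (fun i j => f (i, j)) 0
  simp only [Pi.zero_apply, add_zero] at h1 h2
  rw [sortCount, card_compat _ _ hn, ← h2]
  exact if_pos h1

theorem sum_sortCount_rows {X : Type*} [LinearOrder X] [Fintype X] {n : ℕ}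
    [Fintype (Neck r X)] (hn : Nat.card (Fin s × ZMod r) = n) (C : (Fin s × ZMod r → X) → Prop)
    [DecidablePred C] (hC : ∀ f f', content f = content f' → (C f ↔ C f')) :
    ∑ f : Fin s × ZMod r → X, (if C f then (sortCount n (rowShift s r) f : ℚ) else 0) =
      r ^ s * ∑ x : Fin s → Neck r X, if C (fun p => (x p.1).word p.2) then
        (Nat.card {ρ : Equiv.Perm (Fin s) // ∀ i, x (ρ i) = x i} : ℚ) else 0 := by
  classical
  have h := sum_isPrim_rows (s := s) (r := r) (G := Neck.word (r := r) (X := X)) Neck.word_rigid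
    Neck.exists_word (fun f => if C f then 1 else 0) fun x c => by
      have : C (fun p => (x p.1).word (p.2 + c p.1)) ↔ C fun p => (x p.1).word p.2 := by
        apply hC
        rw [content_prod, content_prod]
        exact sum_congr rfl fun i _ => content_comp_equiv (x i).word (Equiv.addRight (c i))
      simp only [this]
  simp only [ite_mul, one_mul, zero_mul] at h
  rw [← h]
  refine sum_congr rfl fun f _ => ?_
  congr 1
  rw [sortCount, card_compat _ _ hn]
  push_cast
  congr 1

theorem hasCyclicExtension_of_squareful {n : ℕ} [NeZero n] (hr : r = q * e) (hqe : q ∣ e)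
    (hq : 2 ≤ q) (hs : 1 ≤ s) (hn : Nat.card (Fin s × ZMod r) = n) (τ₁ : Fin s × ZMod r ≃ Fin n)
    (P : Multiset ℕ) (hP : fullCycleType (τ₁.permCongr (rowShift s r)) = P) :
    HasCyclicExtension n
      (fun π : {π : Equiv.Perm (Fin n) // fullCycleType π = P} => Des π.1) := by
  classical
  have : Fintype (Neck r (Fin n)) := Fintype.ofFinite _
  let ε : ZMod r ≃ ZMod q × Fin e := Fintype.equivOfCardEq (by
    rw [Fintype.card_prod, ZMod.card, ZMod.card, Fintype.card_fin, hr])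
  let φ : ZMod q ≃ Fin q := Fintype.equivOfCardEq (by rw [ZMod.card, Fintype.card_fin])
  let κ : ZMod r → Fin q ×ₗ Fin e := fun j => toLex (φ (ε j).1, (ε j).2)
  have hκi : Function.Injective κ := fun j j' h => by
    have h1 := toLex.injective h
    simp only [Prod.mk.injEq] at h1
    exact ε.injective (Prod.ext (φ.injective h1.1) h1.2)
  let A : Fin s × ZMod r → Prop := fun p => (φ (ε p.2).1 : ℕ) = q - 1
  let D : (Fin s × ZMod r → Fin n) → Prop := fun f => ∀ i,
    IsBalanced fun b => blockEquiv s ε f (i, b)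
  have hbal : ∀ v v' : ZMod q → Fin e → Fin n, (∀ b, invCount (v b) = invCount (v' b)) →
      (IsBalanced v ↔ IsBalanced v') := fun v v' h => by
    simp only [IsBalanced, h]
  choose ψ hψ using exists_equiv_content_invCount (n := n) e
  let Ψ : Fin n → Equiv.Perm (Fin s × ZMod r → Fin n) := fun c =>
    ((blockEquiv s ε).trans (Equiv.piCongrRight fun _ => ψ c)).trans (blockEquiv s ε).symm
  have hΨ : ∀ c f p, blockEquiv s ε (Ψ c f) p = ψ c (blockEquiv s ε f p) := fun c f p => by
    simp only [Ψ, Equiv.trans_apply, Equiv.apply_symm_apply]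
    rfl
  refine hasCyclicExtension_of_refinement hn (rowShift s r) τ₁ P hP (fun p => κ p.2) A D ?_
    (a₀ := (⟨0, hs⟩, ε.symm (φ.symm ⟨q - 1, by omega⟩, 0)))
    (b₀ := (⟨0, hs⟩, ε.symm (φ.symm ⟨0, by omega⟩, 0))) ?_ ?_ ?_ Ψ ?_ ?_ ?_ (1 / r ^ s) ?_ ?_
  · intro a b ha hb
    refine Prod.Lex.toLex_lt_toLex.2 (Or.inl ?_)
    have := (φ (ε b.2).1).isLt
    simp only [A] at ha hb
    change (φ (ε b.2).1 : ℕ) < φ (ε a.2).1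
    omega
  · simp [A]
  · simp only [A, Equiv.apply_symm_apply]
    omega
  · intro f τ hτ
    rw [compat_pairLabel_iff] at hτ
    refine forall_congr' fun i => hbal _ _ fun b => invCount_congr fun c c' hcc => ?_
    simp only [blockEquiv_apply]
    have hκ : κ (ε.symm (b, c)) < κ (ε.symm (b, c')) := by
      simp only [κ, Equiv.apply_symm_apply]
      exact Prod.Lex.toLex_lt_toLex.2 (Or.inr ⟨rfl, hcc⟩)
    have hkey : sortKey (rowShift s r) (fun p => κ p.2) τ (i, ε.symm (b, c)) <
        sortKey (rowShift s r) (fun p => κ p.2) τ (i, ε.symm (b, c')) :=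
      Prod.Lex.toLex_lt_toLex.2 (Or.inl hκ)
    constructor
    · intro h
      rcases hτ _ _ h with h | h
      · exact h
      · exact absurd h.2 hkey.not_gt
    · intro h
      by_contra hle
      rcases (not_lt.1 hle).lt_or_eq with hlt | heq
      · rcases hτ _ _ hlt with h' | h'
        · exact h'.not_gt h
        · exact h.ne' h'.1
      · rw [τ.injective heq] at h
        exact lt_irrefl _ h
  · intro c f
    have h1 : ∀ p, ∃ e' : Fin e ≃ Fin e, ∀ x, ψ c (blockEquiv s ε f p) (e' x) =
        blockEquiv s ε f p x := fun p => exists_equiv_of_card_fiber _ _ fun x =>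
          sameContent_of_content_eq (hψ c (blockEquiv s ε f p)).1.symm x
    choose e' he' using h1
    let g := (Equiv.prodCongr (Equiv.refl (Fin s)) ε).trans (Equiv.prodAssoc _ _ _).symm
    refine ⟨(g.trans (Equiv.prodCongrRight e')).trans g.symm, fun x => ?_, fun x => ?_⟩
    · simp [A, g]
    · rw [apply_eq_blockEquiv ε (Ψ c f), hΨ, apply_eq_blockEquiv ε f x, ← he']
      simp [g]
  · intro c f
    rw [sortCount_pairLabel_rows hn hκi, sortCount_pairLabel_rows hn hκi]
    refine Nat.card_congr (Equiv.subtypeEquivRight fun ρ => forall_congr' fun i => ?_)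
    rw [row_eq_iff_blockEquiv ε, row_eq_iff_blockEquiv ε]
    simp only [hΨ, EmbeddingLike.apply_eq_iff_eq]
  · intro c f
    refine forall_congr' fun i => hbal _ _ fun b => ?_
    rw [hΨ, (hψ c _).2]
    rfl
  · have := Nat.pos_of_ne_zero (NeZero.ne r)
    positivity
  · intro I h0
    have hr0 : (r : ℚ) ^ s ≠ 0 := pow_ne_zero _ (Nat.cast_ne_zero.2 (NeZero.ne r))
    have hSC : ∀ f f' : Fin s × ZMod r → Fin n, content f = content f' →
        (SameContent f (blockStart I) ↔ SameContent f' (blockStart I)) := fun f f' h =>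
      ⟨(sameContent_of_content_eq h).symm.trans, (sameContent_of_content_eq h).trans⟩
    have key := sum_sortCount_rows hn (fun f => SameContent f (blockStart I)) hSC
    refine Eq.trans ?_ (congrArg (1 / (r : ℚ) ^ s * ·)
      (key.symm.trans (sum_congr (by ext; simp) fun f _ => if_congr Iff.rfl rfl rfl)))
    rw [← mul_assoc, one_div, inv_mul_cancel₀ hr0, one_mul]
    obtain ⟨β, hβ⟩ := exists_equiv_neck_isBalanced (X := Fin n) hr hqe
    let F : (Fin s → Neck r (Fin n)) → (Fin s × ZMod r → Fin n) :=
      fun x p => (β (x p.1)).1 (ε p.2).1 (ε p.2).2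
    have hF : ∀ x p, blockEquiv s ε (F x) p = (β (x p.1)).1 p.2 := fun x p => by
      ext c
      simp [blockEquiv_apply, F]
    have hFrow : ∀ x i i', ((fun j => F x (i, j)) = fun j => F x (i', j)) ↔ x i = x i' :=
      fun x i i' => by
        rw [row_eq_iff_blockEquiv ε]
        simp only [hF]
        rw [← funext_iff, ← Subtype.ext_iff, β.injective.eq_iff]
    have hFc : ∀ x, content (F x) = content fun p : Fin s × ZMod r => (x p.1).word p.2 :=
      fun x => by
        rw [content_prod, content_prod]
        refine sum_congr rfl fun i _ => ?_
        rw [← hβ (x i), blockContent,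
          ← content_comp_equiv (fun p : ZMod q × Fin e => (β (x i)).1 p.1 p.2) ε]
    refine Eq.trans (b := ∑ f : Fin s × ZMod r → Fin n with D f,
      if SameContent f (blockStart I) then
        (sortCount n (rowShift s r) (pairLabel f fun p => κ p.2) : ℚ) else 0) ?_ ?_
    · rw [sum_filter]
      refine sum_congr (by ext; simp) fun f _ => ?_
      by_cases hD : D f <;> simp [hD]
    symm
    refine sum_bij (fun x _ => F x) ?_ ?_ ?_ ?_
    · intro x _
      rw [mem_filter]
      refine ⟨mem_univ _, fun i => ?_⟩
      simp only [hF]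
      exact (β (x i)).2
    · intro x _ x' _ h
      ext i
      apply β.injective
      apply Subtype.ext
      ext b : 1
      rw [← hF x (i, b), ← hF x' (i, b), h]
    · intro f hf
      have hDf := (mem_filter.1 hf).2
      let x : Fin s → Neck r (Fin n) := fun i => β.symm ⟨_, hDf i⟩
      refine ⟨x, mem_univ _, ?_⟩
      apply (blockEquiv s ε).injective
      ext p : 1
      refine (hF x p).trans ?_
      rw [Equiv.apply_symm_apply]
    · intro x _
      rw [sortCount_pairLabel_rows hn hκi]
      simp only [hFrow]
      exact if_congr (hSC _ _ (hFc x).symm) rfl rfl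

end Squareful

theorem card_strictMono_fin (m k : ℕ) :
    Nat.card {g : Fin m → Fin k // StrictMono g} = k.choose m := by
  have e : {g : Fin m → Fin k // StrictMono g} ≃ (Fin m ↪o Fin k) :=
    { toFun := fun g => OrderEmbedding.ofStrictMono g.1 g.2
      invFun := fun f => ⟨f, f.strictMono⟩
      left_inv := fun _ => rfl
      right_inv := fun _ => by ext; rfl }
  rw [Nat.card_congr e, Nat.card_congr Set.powersetCard.ofFinEmbEquiv, Set.powersetCard.card,
    Nat.card_fin]

section Ascents

variable {X : Type*} [LinearOrder X] {m : ℕ}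

/-- The number of ascents of `π` among positions up to `i`. -/
def ascCount (π : Fin (m + 1) → X) (i : Fin (m + 1)) : ℕ :=
  #{j : Fin m | j.castSucc < i ∧ π j.castSucc < π j.succ}

theorem ascCount_zero (π : Fin (m + 1) → X) : ascCount π 0 = 0 := by
  simp [ascCount]

theorem ascCount_succ (π : Fin (m + 1) → X) (i : Fin m) :
    ascCount π i.succ = ascCount π i.castSucc + if π i.castSucc < π i.succ then 1 else 0 := by
  have h : ∀ j : Fin m, j.castSucc < i.succ ↔ j.castSucc < i.castSucc ∨ j = i := fun j => by
    simp only [Fin.lt_def, Fin.val_castSucc, Fin.val_succ, Fin.ext_iff]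
    omega
  simp only [ascCount, h, or_and_right, filter_or]
  rw [card_union_of_disjoint]
  · congr 1
    split_ifs with hi
    · rw [card_eq_one]
      refine ⟨i, ?_⟩
      ext j
      simp only [mem_filter, mem_univ, true_and, mem_singleton]
      exact ⟨fun h => h.1, fun h => ⟨h, h ▸ hi⟩⟩
    · rw [card_eq_zero, filter_eq_empty_iff]
      rintro j - ⟨rfl, hj⟩
      exact hi hj
  · rw [disjoint_filter]
    rintro j - ⟨h1, -⟩ ⟨rfl, -⟩
    exact lt_irrefl _ h1

theorem ascCount_le_last (π : Fin (m + 1) → X) (i : Fin (m + 1)) :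
    ascCount π i ≤ ascCount π (Fin.last m) :=
  card_le_card fun j hj => by
    simp only [mem_filter, mem_univ, true_and] at hj ⊢
    exact ⟨hj.1.trans_le (Fin.le_last i), hj.2⟩

theorem ascCount_last (π : Fin (m + 1) → X) :
    ascCount π (Fin.last m) = #{j : Fin m | π j.castSucc < π j.succ} := by
  simp [ascCount, Fin.castSucc_lt_last]

theorem card_strictMono_toLex (π : Fin (m + 1) → X) (k : ℕ) :
    Nat.card {h : Fin (m + 1) → Fin k // StrictMono fun i => toLex (h i, π i)} =
      (k + ascCount π (Fin.last m)).choose (m + 1) := by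
  set a := ascCount π (Fin.last m) with ha
  rw [← card_strictMono_fin]
  have hstep : ∀ (h g : Fin (m + 1) → ℕ), (∀ i, g i = h i + ascCount π i) → ∀ i : Fin m,
      (g i.castSucc < g i.succ ↔ h i.castSucc < h i.succ ∨
        h i.castSucc = h i.succ ∧ π i.castSucc < π i.succ) := by
    intro h g hg i
    rw [hg, hg, ascCount_succ]
    split_ifs with hi
    · simp only [hi, and_true]
      omega
    · simp only [hi, and_false, or_false]
      omega
  have hlex : ∀ h : Fin (m + 1) → Fin k, (StrictMono fun i => toLex (h i, π i)) ↔
      ∀ i : Fin m, (h i.castSucc : ℕ) < h i.succ ∨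
        (h i.castSucc : ℕ) = h i.succ ∧ π i.castSucc < π i.succ := fun h => by
    simp only [Fin.strictMono_iff_lt_succ, Prod.Lex.toLex_lt_toLex, Fin.lt_def, Fin.ext_iff]
  have hmono : ∀ g : Fin (m + 1) → Fin (k + a), StrictMono g →
      Monotone fun i => ((g i : ℕ) : ℤ) - ascCount π i := fun g hg => by
    rw [Fin.monotone_iff_le_succ]
    intro i
    have h1 : (g i.castSucc : ℕ) < g i.succ := hg i.castSucc_lt_succ
    simp only [ascCount_succ]
    split_ifs <;> push_cast <;> omega
  have hge : ∀ g : Fin (m + 1) → Fin (k + a), StrictMono g → ∀ i, ascCount π i ≤ g i :=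
    fun g hg i => by
      have h1 := hmono g hg (Fin.zero_le i)
      simp only [ascCount_zero] at h1
      omega
  have hlt : ∀ g : Fin (m + 1) → Fin (k + a), StrictMono g → ∀ i, (g i : ℕ) - ascCount π i < k :=
    fun g hg i => by
      have h1 := hmono g hg (Fin.le_last i)
      have h2 := hge g hg i
      have h3 := (g (Fin.last m)).isLt
      simp only at h1
      omega
  refine Nat.card_congr
    { toFun := fun h => ⟨fun i => ⟨h.1 i + ascCount π i, ?_⟩, ?_⟩
      invFun := fun g => ⟨fun i => ⟨g.1 i - ascCount π i, hlt g.1 g.2 i⟩, ?_⟩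
      left_inv := fun h => ?_
      right_inv := fun g => ?_ }
  · have := ascCount_le_last π i
    have := (h.1 i).isLt
    omega
  · rw [Fin.strictMono_iff_lt_succ]
    intro i
    exact (hstep (fun i => h.1 i) (fun i => h.1 i + ascCount π i) (fun _ => rfl) i).2
      ((hlex _).1 h.2 i)
  · rw [hlex]
    intro i
    refine (hstep (fun i => (g.1 i : ℕ) - ascCount π i) (fun i => g.1 i) (fun i => ?_) i).1
      (g.2 i.castSucc_lt_succ)
    have := hge g.1 g.2 i
    omega
  · ext i
    simp
  · ext i
    have := hge g.1 g.2 i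
    simp only
    omega

end Ascents

theorem rot_erase {n : ℕ} [NeZero n] (J : Finset (Fin n)) (i : Fin n) :
    (rot 1 J).erase (i + 1) = rot 1 (J.erase i) := by
  ext j
  simp only [mem_erase, mem_rot, ne_eq, sub_eq_iff_eq_add]

theorem card_rot {n : ℕ} [NeZero n] (c : Fin n) (J : Finset (Fin n)) : #(rot c J) = #J := by
  refine card_bij' (fun j _ => j - c) (fun j _ => j + c) ?_ ?_ ?_ ?_ <;>
    intro j hj <;> simp_all [mem_rot]

/-- The linear coefficient of the number of monotone maps with `d` forced strict steps, up to
normalization. -/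
def desWeight (m d : ℕ) : ℚ := (-1) ^ d * d.factorial * (m - d).factorial

theorem desWeight_sum_erase {m : ℕ} {J : Finset (Fin (m + 1))} (h0 : J ≠ ∅) (h1 : J ≠ univ) :
    ∑ i, desWeight m #(J.erase i) = 0 := by
  have hpos : 0 < #J := card_pos.2 (nonempty_iff_ne_empty.2 h0)
  have hlt : #J < m + 1 := by
    obtain ⟨x, hx⟩ : ∃ x, x ∉ J := by
      by_contra! h
      exact h1 (eq_univ_of_forall h)
    simpa using card_lt_univ_of_notMem hx
  rw [← sum_filter_add_sum_filter_not univ (· ∈ J)]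
  have e1 : ∑ i with i ∈ J, desWeight m #(J.erase i) = #J * desWeight m (#J - 1) := by
    rw [filter_mem_eq_inter, univ_inter, ← nsmul_eq_mul, ← sum_const]
    exact sum_congr rfl fun i hi => by rw [card_erase_of_mem hi]
  have e2 : ∑ i with i ∉ J, desWeight m #(J.erase i) = ((m + 1 - #J : ℕ) : ℚ) * desWeight m #J := by
    have hc : #(univ.filter fun i => i ∉ J) = m + 1 - #J := by
      have := card_compl J
      rw [Fintype.card_fin] at this
      rw [← this]
      congr 1
      ext
      simp
    rw [← hc, ← nsmul_eq_mul, ← sum_const]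
    exact sum_congr rfl fun i hi => by rw [erase_eq_of_notMem (mem_filter.1 hi).2]
  rw [e1, e2]
  obtain ⟨c, hc⟩ := Nat.exists_eq_succ_of_ne_zero hpos.ne'
  obtain ⟨b, rfl⟩ : ∃ b, m = c + 1 + b := ⟨m - (c + 1), by omega⟩
  rw [hc]
  simp only [desWeight, Nat.succ_eq_add_one, Nat.add_sub_cancel]
  rw [show c + 1 + b + 1 - (c + 1) = b + 1 by omega, show c + 1 + b - c = b + 1 by omega,
    show c + 1 + b - (c + 1) = b by omega, Nat.factorial_succ c, Nat.factorial_succ b]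
  push_cast
  ring

theorem sum_desWeight_eq_zero {m : ℕ} {T : Type*} [Fintype T] (cD : T → Finset (Fin (m + 1)))
    (p : T ≃ T) (h : ∀ t, cD (p t) = rot 1 (cD t) ∧ cD t ≠ ∅ ∧ cD t ≠ univ) :
    ∑ t, desWeight m #((cD t).erase 0) = 0 := by
  have h1 : ∀ i : Fin (m + 1), ∑ t, desWeight m #((cD t).erase (i + 1)) =
      ∑ t, desWeight m #((cD t).erase i) := fun i => by
    rw [← Equiv.sum_comp p]
    refine sum_congr rfl fun t _ => ?_
    rw [(h t).1, rot_erase, card_rot]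
  have h2 : ∀ i : Fin (m + 1), ∑ t, desWeight m #((cD t).erase i) =
      ∑ t, desWeight m #((cD t).erase 0) := fun i => by
    induction i using Fin.induction with
    | zero => rfl
    | succ i ih => rw [← ih, ← h1 i.castSucc, Fin.coeSucc_eq_succ]
  have h3 : ∑ i : Fin (m + 1), ∑ t, desWeight m #((cD t).erase i) = 0 := by
    rw [sum_comm]
    exact sum_eq_zero fun t _ => desWeight_sum_erase (h t).2.1 (h t).2.2
  simp only [h2, sum_const, card_univ, Fintype.card_fin, nsmul_eq_mul] at h3
  exact (mul_eq_zero.1 h3).resolve_left (by positivity)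

theorem card_finDes_add_ascCount {m : ℕ} (π : Equiv.Perm (Fin (m + 1))) :
    #(finDes π) + ascCount π (Fin.last m) = m := by
  have h1 : #(finDes π) = #{j : Fin m | ¬ π j.castSucc < π j.succ} := by
    symm
    refine card_bij (fun j _ => j.succ) ?_ ?_ ?_
    · intro j hj
      simp only [finDes, mem_filter, mem_univ, true_and] at hj ⊢
      refine ⟨Fin.succ_ne_zero j, ?_⟩
      rw [← Fin.coeSucc_eq_succ, add_sub_cancel_right, Fin.coeSucc_eq_succ]
      refine lt_of_le_of_ne (not_lt.1 hj) fun h => ?_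
      exact j.castSucc_lt_succ.ne' (π.injective h)
    · intro i _ j _ h
      exact Fin.succ_injective _ h
    · intro i hi
      simp only [finDes, mem_filter, mem_univ, true_and] at hi
      obtain ⟨j, rfl⟩ := Fin.exists_succ_eq.2 hi.1
      refine ⟨j, ?_, rfl⟩
      simp only [mem_filter, mem_univ, true_and, not_lt]
      have := hi.2
      rw [← Fin.coeSucc_eq_succ, add_sub_cancel_right, Fin.coeSucc_eq_succ] at this
      exact this.le
  rw [h1, ascCount_last, add_comm, card_filter_add_card_filter_not, card_univ,
    Fintype.card_fin]

theorem sum_sortCount_fin {m : ℕ} {Ω : Type*} [Fintype Ω] [DecidableEq Ω] (σ : Equiv.Perm Ω)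
    (k : ℕ) : ∑ f : Ω → Fin k, sortCount (m + 1) σ f =
      ∑ τ : Ω ≃ Fin (m + 1), (k + ascCount (τ.permCongr σ) (Fin.last m)).choose (m + 1) := by
  classical
  simp only [sortCount, Nat.card_eq_fintype_card, Fintype.card_subtype, card_filter]
  rw [sum_comm]
  refine sum_congr rfl fun τ _ => ?_
  rw [← card_strictMono_toLex, Nat.card_eq_fintype_card, Fintype.card_subtype, card_filter]
  rw [← Equiv.sum_comp (Equiv.arrowCongr τ (Equiv.refl (Fin k)))]
  refine sum_congr rfl fun f _ => if_congr ?_ rfl rfl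
  simp only [Compat, StrictMono, Prod.Lex.toLex_lt_toLex]
  constructor
  · intro h i j hij
    simpa using h (τ.symm i) (τ.symm j) (by simpa using hij)
  · intro h x y hxy
    simpa using h hxy

theorem sum_card_perm_fixing {S : Type*} [Fintype S] [DecidableEq S] (s : ℕ) :
    ∑ ρ : Equiv.Perm (Fin s), #{x : Fin s → S | ∀ i, x (ρ i) = x i} =
      ∏ i ∈ range s, (Fintype.card S + i) := by
  induction s with
  | zero => simp
  | succ s ih =>
    have hfix : ∀ (p : Fin (s + 1)) (e : Equiv.Perm (Fin s)) (a : S) (x : Fin s → S),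
        (∀ i, (Fin.cons a x : Fin (s + 1) → S) (Equiv.Perm.decomposeFin.symm (p, e) i) =
          (Fin.cons a x : Fin (s + 1) → S) i) ↔
        (Fin.cons a x : Fin (s + 1) → S) p = a ∧ ∀ i, x (e i) = x i := by
      intro p e a x
      rw [Fin.forall_fin_succ]
      simp only [Equiv.Perm.decomposeFin_symm_apply_zero, Fin.cons_zero,
        Equiv.Perm.decomposeFin_symm_apply_succ, Fin.cons_succ]
      refine and_congr_right fun hp => forall_congr' fun i => ?_
      have : ∀ j, (Fin.cons a x : Fin (s + 1) → S) (Equiv.swap 0 p j) =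
          (Fin.cons a x : Fin (s + 1) → S) j := fun j => by
        rw [Equiv.swap_apply_def]
        split_ifs with h1 h2
        · rw [h1, hp, Fin.cons_zero]
        · rw [h2, hp, Fin.cons_zero]
        · rfl
      rw [this, Fin.cons_succ]
    have hcard : ∀ (p : Fin (s + 1)) (e : Equiv.Perm (Fin s)),
        #{x : Fin (s + 1) → S | ∀ i, x (Equiv.Perm.decomposeFin.symm (p, e) i) = x i} =
        (if p = 0 then Fintype.card S else 1) * #{x : Fin s → S | ∀ i, x (e i) = x i} := by
      intro p e
      rw [card_filter, ← Equiv.sum_comp (Fin.consEquiv fun _ => S), Fintype.sum_prod_type,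
        sum_comm, card_filter, mul_sum]
      refine sum_congr rfl fun x _ => ?_
      simp only [Fin.consEquiv_apply, hfix]
      by_cases hx : ∀ i, x (e i) = x i
      · simp only [hx, implies_true, and_true, if_true, mul_one]
        refine Fin.cases ?_ (fun j => ?_) p
        · simp
        · simp [Fin.succ_ne_zero]
      · simp [hx]
    rw [← Equiv.sum_comp Equiv.Perm.decomposeFin.symm, Fintype.sum_prod_type]
    simp only [hcard, ← mul_sum, ← sum_mul, ih]
    rw [prod_range_succ, mul_comm, Fin.sum_univ_succ]
    simp [Fin.succ_ne_zero]

theorem sum_card_stabilizer {S : Type*} [Fintype S] [DecidableEq S] (s : ℕ) :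
    ∑ x : Fin s → S, (Nat.card {ρ : Equiv.Perm (Fin s) // ∀ i, x (ρ i) = x i} : ℚ) =
      ∏ i ∈ range s, ((Fintype.card S : ℚ) + i) := by
  have h := sum_card_perm_fixing (S := S) s
  simp only [card_filter] at h
  rw [sum_comm] at h
  have h1 : ∏ i ∈ range s, ((Fintype.card S : ℚ) + i) =
      ((∏ i ∈ range s, (Fintype.card S + i) : ℕ) : ℚ) := by push_cast; rfl
  rw [h1, ← h]
  push_cast
  refine sum_congr rfl fun x _ => ?_
  rw [Nat.card_eq_fintype_card, Fintype.card_subtype, ← sum_boole]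

section Choose

open Polynomial

theorem exists_choose_polynomial {m a : ℕ} (ha : a ≤ m) : ∃ Q : ℚ[X],
    (∀ k : ℕ, ((m + 1).factorial : ℚ) * ((k + a).choose (m + 1) : ℚ) = k * Q.eval (k : ℚ)) ∧
      Q.eval 0 = desWeight m (m - a) := by
  obtain ⟨b, rfl⟩ := Nat.exists_eq_add_of_le ha
  refine ⟨(∏ j ∈ range a, (X + C ((a : ℚ) - j))) * ∏ j ∈ range b, (X - C ((j : ℚ) + 1)),
    fun k => ?_, ?_⟩
  · rw [← Nat.cast_mul, ← Nat.descFactorial_eq_factorial_mul_choose,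
      ← descPochhammer_eval_eq_descFactorial, descPochhammer_eval_eq_prod_range,
      show a + b + 1 = a + 1 + b by ring, prod_range_add, prod_range_succ]
    simp only [eval_mul, eval_prod, eval_add, eval_sub, eval_X, eval_C]
    push_cast
    have h1 : ∀ j ∈ range a, (k : ℚ) + a - j = k + (a - j) := fun j _ => by ring
    have h2 : ∀ j ∈ range b, (k : ℚ) + a - (a + 1 + j) = k - (j + 1) := fun j _ => by ring
    rw [prod_congr rfl h1, prod_congr rfl h2]
    ring
  · simp only [eval_mul, eval_prod, eval_add, eval_sub, eval_X, eval_C, zero_add, zero_sub]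
    rw [desWeight, Nat.add_sub_cancel_left, Nat.add_sub_cancel, prod_neg]
    have h1 : ∏ j ∈ range a, ((a : ℚ) - j) = a.factorial := by
      rw [← descPochhammer_eval_eq_prod_range, descPochhammer_eval_eq_descFactorial,
        Nat.descFactorial_self]
    have h2 : ∏ j ∈ range b, ((j : ℚ) + 1) = b.factorial := by
      rw [← prod_range_add_one_eq_factorial]
      push_cast
      rfl
    rw [h1, h2, card_range]
    ring

end Choose

section PrimitiveWordCount

variable {r : ℕ} [NeZero r]

theorem natCast_gcd_mem {H : AddSubgroup (ZMod r)} {m : ℕ} (hm : (m : ZMod r) ∈ H) :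
    ((m.gcd r : ℕ) : ZMod r) ∈ H := by
  have h : ((m.gcd r : ℕ) : ZMod r) = (m.gcdA r) • (m : ZMod r) := by
    have := congrArg (Int.cast (R := ZMod r)) (Nat.gcd_eq_gcd_ab m r)
    push_cast at this
    rw [this, ZMod.natCast_self, zero_mul, add_zero, zsmul_eq_mul, mul_comm]
  rw [h]
  exact H.zsmul_mem hm _

theorem natCast_mem_of_dvd {H : AddSubgroup (ZMod r)} {m l : ℕ} (hm : (m : ZMod r) ∈ H)
    (h : m ∣ l) : (l : ZMod r) ∈ H := by
  obtain ⟨k, rfl⟩ := h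
  rw [mul_comm, Nat.cast_mul, ← nsmul_eq_mul]
  exact H.nsmul_mem hm k

theorem primWord_iff_primeFactors {X : Type*} {w : ZMod r → X} :
    PrimWord w ↔ ∀ p ∈ r.primeFactors, ((r / p : ℕ) : ZMod r) ∉ wordStab w := by
  have hr := Nat.pos_of_ne_zero (NeZero.ne r)
  constructor
  · intro hw p hp h
    have hpp := Nat.prime_of_mem_primeFactors hp
    have hpr := Nat.dvd_of_mem_primeFactors hp
    have h1 := hw _ h
    rw [ZMod.natCast_eq_zero_iff] at h1
    exact absurd (Nat.le_of_dvd (Nat.div_pos (Nat.le_of_dvd hr hpr) hpp.pos) h1)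
      (not_le.2 (Nat.div_lt_self hr hpp.one_lt))
  · intro h t ht
    by_contra hne
    obtain ⟨m, rfl⟩ := ZMod.natCast_zmod_surjective t
    have hg := natCast_gcd_mem (H := wordStab w) (mem_wordStab.2 ht)
    obtain ⟨c, hc⟩ := Nat.gcd_dvd_right m r
    have hc1 : c ≠ 1 := by
      rintro rfl
      rw [mul_one] at hc
      exact hne ((ZMod.natCast_eq_zero_iff _ _).2 (hc ▸ Nat.gcd_dvd_left m r))
    obtain ⟨p, hp, d, rfl⟩ := Nat.exists_prime_and_dvd hc1
    refine h p (Nat.mem_primeFactors.2 ⟨hp, ?_, hr.ne'⟩) (natCast_mem_of_dvd hg ?_)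
    · exact (Dvd.intro d rfl).trans (Dvd.intro_left _ hc.symm)
    · refine ⟨d, Nat.div_eq_of_eq_mul_left hp.pos ?_⟩
      rw [mul_assoc, mul_comm d p]
      exact hc

/-- The subgroup generated by the elements `r / p` for `p ∈ T`. -/
def primeSubgroup (r : ℕ) (T : Finset ℕ) : AddSubgroup (ZMod r) :=
  AddSubgroup.closure ((fun p => ((r / p : ℕ) : ZMod r)) '' T)

theorem primeSubgroup_le {T : Finset ℕ} {H : AddSubgroup (ZMod r)} :
    primeSubgroup r T ≤ H ↔ ∀ p ∈ T, ((r / p : ℕ) : ZMod r) ∈ H := by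
  rw [primeSubgroup, AddSubgroup.closure_le, Set.image_subset_iff]
  rfl

theorem primeSubgroup_eq_top_iff (hr : Squarefree r) {T : Finset ℕ} (hT : T ⊆ r.primeFactors) :
    primeSubgroup r T = ⊤ ↔ T = r.primeFactors := by
  have hr0 := Nat.pos_of_ne_zero (NeZero.ne r)
  constructor
  · intro h
    refine hT.antisymm fun p hp => ?_
    by_contra hpT
    have hpp := Nat.prime_of_mem_primeFactors hp
    have hpr := Nat.dvd_of_mem_primeFactors hp
    let H : AddSubgroup (ZMod r) := (AddMonoidHom.mulLeft ((r / p : ℕ) : ZMod r)).ker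
    have hle : primeSubgroup r T ≤ H := by
      rw [primeSubgroup_le]
      intro q hq
      change ((r / p : ℕ) : ZMod r) * ((r / q : ℕ) : ZMod r) = 0
      rw [← Nat.cast_mul, ZMod.natCast_eq_zero_iff]
      have hqp := Nat.prime_of_mem_primeFactors (hT hq)
      have hqr := Nat.dvd_of_mem_primeFactors (hT hq)
      have hne : p ≠ q := fun h => hpT (h ▸ hq)
      have hpq : p * q ∣ r := Nat.Coprime.mul_dvd_of_dvd_of_dvd
        ((Nat.coprime_primes hpp hqp).2 hne) hpr hqr
      obtain ⟨d, hd⟩ := hpq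
      have e1 : r / p = q * d := Nat.div_eq_of_eq_mul_right hpp.pos (by rw [hd]; ring)
      have e2 : r / q = p * d := Nat.div_eq_of_eq_mul_right hqp.pos (by rw [hd]; ring)
      rw [e1, e2]
      exact ⟨d, by rw [hd]; ring⟩
    have h1 : (1 : ZMod r) ∈ H := hle (h ▸ AddSubgroup.mem_top _)
    change ((r / p : ℕ) : ZMod r) * 1 = 0 at h1
    rw [mul_one, ZMod.natCast_eq_zero_iff] at h1
    exact absurd (Nat.le_of_dvd (Nat.div_pos (Nat.le_of_dvd hr0 hpr) hpp.pos) h1)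
      (not_le.2 (Nat.div_lt_self hr0 hpp.one_lt))
  · rintro rfl
    have hmem := primeSubgroup_le.1 (le_refl (primeSubgroup r r.primeFactors))
    set H := primeSubgroup r r.primeFactors
    let o := addOrderOf (QuotientAddGroup.mk 1 : ZMod r ⧸ H)
    have ho : ∀ l : ℕ, (l : ZMod r) ∈ H → o ∣ l := fun l hl => by
      rw [addOrderOf_dvd_iff_nsmul_eq_zero, ← QuotientAddGroup.mk_nsmul,
        QuotientAddGroup.eq_zero_iff, nsmul_eq_mul, mul_one]
      exact hl
    have hor : o ∣ r := ho r (by rw [ZMod.natCast_self]; exact H.zero_mem)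
    have ho1 : o = 1 := by
      by_contra hne
      obtain ⟨p, hp, hpo⟩ := Nat.exists_prime_and_dvd hne
      have hpr := hpo.trans hor
      have h1 : p ∣ r / p := hpo.trans (ho _ (hmem p (Nat.mem_primeFactors.2 ⟨hp, hpr, hr0.ne'⟩)))
      have h2 : p * p ∣ r := by
        rw [← Nat.div_mul_cancel hpr]
        exact Nat.mul_dvd_mul_right h1 p
      exact hp.one_lt.ne' (Nat.isUnit_iff.1 (hr p h2))
    rw [AddMonoid.addOrderOf_eq_one_iff, QuotientAddGroup.eq_zero_iff] at ho1
    rw [AddSubgroup.eq_top_iff']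
    intro x
    obtain ⟨l, rfl⟩ := ZMod.natCast_zmod_surjective x
    exact natCast_mem_of_dvd (by rwa [Nat.cast_one]) (one_dvd l)

theorem card_primWord (r k : ℕ) [NeZero r] : (Nat.card {w : ZMod r → Fin k // PrimWord w} : ℚ) =
    ∑ T ∈ r.primeFactors.powerset, (-1) ^ #T * (k : ℚ) ^ Nat.card (ZMod r ⧸ primeSubgroup r T) := by
  classical
  have h1 : ∀ w : ZMod r → Fin k, (if PrimWord w then (1 : ℚ) else 0) =
      ∑ T ∈ r.primeFactors.powerset, (-1) ^ #T *
        if ∀ h ∈ primeSubgroup r T, ∀ j, w (j + h) = w j then ∏ j : ZMod r, (1 : ℚ) else 0 := by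
    intro w
    have h2 : (if PrimWord w then (1 : ℚ) else 0) = ∏ p ∈ r.primeFactors,
        (-(if ((r / p : ℕ) : ZMod r) ∈ wordStab w then (1 : ℚ) else 0) + 1) := by
      split_ifs with hw
      · symm
        refine prod_eq_one fun p hp => ?_
        rw [if_neg (primWord_iff_primeFactors.1 hw p hp), neg_zero, zero_add]
      · rw [primWord_iff_primeFactors] at hw
        push Not at hw
        obtain ⟨p, hp, h⟩ := hw
        symm
        apply prod_eq_zero hp
        rw [if_pos h, neg_add_cancel]
    rw [h2, prod_add]
    refine sum_congr rfl fun T _ => ?_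
    rw [prod_const_one, mul_one, prod_neg, prod_const_one]
    congr 1
    have h3 : (∀ h ∈ primeSubgroup r T, ∀ j, w (j + h) = w j) ↔
        ∀ p ∈ T, ((r / p : ℕ) : ZMod r) ∈ wordStab w :=
      primeSubgroup_le (H := wordStab w)
    simp only [h3]
    split_ifs with h
    · exact prod_eq_one fun p hp => if_pos (h p hp)
    · push Not at h
      obtain ⟨p, hp, h⟩ := h
      exact prod_eq_zero hp (if_neg h)
  rw [Nat.card_eq_fintype_card, Fintype.card_subtype, ← sum_boole, sum_congr rfl fun w _ => h1 w,
    sum_comm]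
  refine sum_congr rfl fun T _ => ?_
  rw [← mul_sum, sum_periodic_words (primeSubgroup r T) fun _ : Fin k => (1 : ℚ)]
  simp

open Polynomial in
theorem exists_neck_polynomial (hr : Squarefree r) : ∃ Q : ℚ[X],
    (∀ k : ℕ, (Nat.card (Neck r (Fin k)) : ℚ) = k * Q.eval (k : ℚ)) ∧ Q.eval 0 ≠ 0 := by
  have hr0 : (r : ℚ) ≠ 0 := Nat.cast_ne_zero.2 (NeZero.ne r)
  refine ⟨C (1 / (r : ℚ)) * ∑ T ∈ r.primeFactors.powerset,
    C ((-1) ^ #T) * X ^ (Nat.card (ZMod r ⧸ primeSubgroup r T) - 1), fun k => ?_, ?_⟩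
  · have h1 := card_primWord r k
    rw [← Nat.card_congr (Neck.prodEquiv r (Fin k)), Nat.card_prod, Nat.card_zmod, Nat.cast_mul] at h1
    rw [← eq_div_iff hr0] at h1
    rw [h1]
    simp only [eval_mul, eval_finsetSum, eval_C, eval_pow, eval_X]
    rw [div_eq_mul_one_div, mul_comm, mul_left_comm]
    congr 1
    rw [mul_sum]
    refine sum_congr rfl fun T _ => ?_
    rw [mul_left_comm, ← pow_succ', Nat.sub_add_cancel Nat.card_pos]
  · simp only [eval_mul, eval_finsetSum, eval_C, eval_pow, eval_X]
    rw [sum_eq_single r.primeFactors]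
    · have : Nat.card (ZMod r ⧸ primeSubgroup r r.primeFactors) = 1 := by
        rw [(primeSubgroup_eq_top_iff hr subset_rfl).2 rfl]
        exact AddSubgroup.index_top
      rw [this]
      simp [NeZero.ne r]
    · intro T hT hne
      have : Nat.card (ZMod r ⧸ primeSubgroup r T) - 1 ≠ 0 := by
        intro h
        have hpos : 0 < Nat.card (ZMod r ⧸ primeSubgroup r T) := Nat.card_pos
        refine hne ((primeSubgroup_eq_top_iff hr (mem_powerset.1 hT)).1 ?_)
        rw [← AddSubgroup.index_eq_one]
        change Nat.card (ZMod r ⧸ primeSubgroup r T) = 1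
        omega
      rw [zero_pow this, mul_zero]
    · intro h
      exact absurd (mem_powerset_self _) h

end PrimitiveWordCount

section AllPeriodsEqual

theorem Equiv.Perm.minimalPeriod_eq_card_support {α : Type*} [Fintype α] [DecidableEq α]
    {σ c : Equiv.Perm α} (hc : c ∈ σ.cycleFactorsFinset) {x : α} (hx : x ∈ c.support) :
    Function.minimalPeriod σ x = #c.support := by
  have hcyc := (Equiv.Perm.mem_cycleFactorsFinset_iff.1 hc).1
  have hco : c = σ.cycleOf x := Equiv.Perm.cycle_is_cycleOf hx hc
  rw [← hcyc.orderOf]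
  have h : ∀ k : ℕ, orderOf c ∣ k ↔ Function.minimalPeriod σ x ∣ k := fun k => by
    rw [orderOf_dvd_iff_pow_eq_one, ← Function.isPeriodicPt_iff_minimalPeriod_dvd,
      Function.IsPeriodicPt, Function.IsFixedPt, ← Equiv.Perm.coe_pow,
      ← Equiv.Perm.cycleOf_pow_apply_self, ← hco]
    constructor
    · intro h
      rw [h, Equiv.Perm.one_apply]
    · intro h
      exact hcyc.pow_eq_one_iff.2 ⟨x, Equiv.Perm.mem_support.1 hx, h⟩
  exact Nat.dvd_antisymm ((h _).1 dvd_rfl) ((h _).2 dvd_rfl)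

theorem exists_fullCycleType_eq_replicate {n r : ℕ} {σ : Equiv.Perm (Fin n)}
    (h : ∀ x, Function.minimalPeriod σ x = r) :
    ∃ s, r * s = n ∧ fullCycleType σ = Multiset.replicate s r := by
  have hmem : ∀ l ∈ fullCycleType σ, l = r := by
    intro l hl
    rw [fullCycleType, Multiset.mem_add, Equiv.Perm.cycleType_def, Multiset.mem_map,
      Multiset.mem_replicate] at hl
    rcases hl with ⟨c, hc, rfl⟩ | ⟨hne, rfl⟩
    · rw [mem_val] at hc
      have hcyc := (Equiv.Perm.mem_cycleFactorsFinset_iff.1 hc).1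
      obtain ⟨x, hx⟩ := hcyc.nonempty_support
      rw [← h x, Equiv.Perm.minimalPeriod_eq_card_support hc hx]
      rfl
    · obtain ⟨x, hx⟩ : ∃ x, x ∉ σ.support := by
        by_contra! hall
        rw [eq_univ_of_forall hall] at hne
        simp at hne
      rw [Equiv.Perm.notMem_support] at hx
      rw [← h x, Function.minimalPeriod_eq_one_iff_isFixedPt.2 hx]
  have hrep := Multiset.eq_replicate_card.2 hmem
  have hsum : (fullCycleType σ).sum = n := by
    rw [fullCycleType_eq_parts, Nat.Partition.parts_sum, Fintype.card_fin]
  rw [hrep, Multiset.sum_replicate, smul_eq_mul, mul_comm] at hsum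
  exact ⟨_, hsum, hrep⟩

theorem minimalPeriod_permCongr_rowShift {n s r : ℕ} [NeZero r] (τ : Fin s × ZMod r ≃ Fin n)
    (x : Fin n) : Function.minimalPeriod (τ.permCongr (rowShift s r)) x = r := by
  have hpow : ∀ k : ℕ, ((τ.permCongr (rowShift s r)) ^ k) x =
      τ ((rowShift s r ^ k) (τ.symm x)) := fun k => by
    induction k with
    | zero => simp
    | succ k ih => simp [pow_succ', Equiv.Perm.mul_apply, ih]
  have h : ∀ k : ℕ, r ∣ k ↔ Function.minimalPeriod (τ.permCongr (rowShift s r)) x ∣ k :=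
    fun k => by
      rw [← Function.isPeriodicPt_iff_minimalPeriod_dvd, Function.IsPeriodicPt,
        Function.IsFixedPt, ← Equiv.Perm.coe_pow, hpow, ← Equiv.eq_symm_apply,
        rowShift_pow_apply, Prod.ext_iff, ← ZMod.natCast_eq_zero_iff]
      simp
  exact Nat.dvd_antisymm ((h _).1 dvd_rfl) ((h _).2 dvd_rfl)

end AllPeriodsEqual

theorem sum_desWeight_eq_zero_of_hasCyclicExtension {m : ℕ} {Ω : Type*} [Fintype Ω]
    [DecidableEq Ω] (σ : Equiv.Perm Ω) (τ₁ : Ω ≃ Fin (m + 1)) (P : Multiset ℕ)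
    (hP : fullCycleType (τ₁.permCongr σ) = P)
    (h : HasCyclicExtension (m + 1)
      (fun π : {π : Equiv.Perm (Fin (m + 1)) // fullCycleType π = P} => Des π.1)) :
    ∑ τ : Ω ≃ Fin (m + 1), desWeight m #(finDes (τ.permCongr σ)) = 0 := by
  rw [hasCyclicExtension_iff _ fun _ => Des_subset_Icc _] at h
  obtain ⟨cD, p, hcD⟩ := h
  have hfin : ∀ t : {π : Equiv.Perm (Fin (m + 1)) // fullCycleType π = P},
      (cD t).erase 0 = finDes t.1 := fun t => by
    ext i
    rw [mem_erase]
    by_cases hi : i = 0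
    · simp [hi, zero_notMem_finDes]
    · rw [(hcD t).1 i hi, posLabel_mem_Des hi]
      simp [hi]
  have hT := sum_desWeight_eq_zero cD p fun t => (hcD t).2
  obtain ⟨Z, -, hZ⟩ := exists_sum_permCongr σ τ₁ P hP
  have hZ' := hZ fun π => desWeight m #(finDes π)
  have hT' : ∑ t : {π : Equiv.Perm (Fin (m + 1)) // fullCycleType π = P},
      desWeight m #(finDes t.1) = 0 := by
    rw [← hT]
    exact sum_congr rfl fun t _ => by rw [hfin]
  refine (sum_congr (by ext; simp) fun _ _ => rfl).trans (hZ'.trans ?_)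
  rw [sum_congr (s₂ := univ) (by ext; simp) fun _ _ => rfl, hT', mul_zero]

open Polynomial in
theorem exists_ascCount_polynomial {m : ℕ} {Ω : Type*} [Fintype Ω] [DecidableEq Ω]
    (σ : Equiv.Perm Ω) : ∃ L : ℚ[X],
      (∀ k : ℕ, ((m + 1).factorial : ℚ) * (∑ f : Ω → Fin k, sortCount (m + 1) σ f : ℕ) =
        k * L.eval (k : ℚ)) ∧
      L.eval 0 = ∑ τ : Ω ≃ Fin (m + 1), desWeight m #(finDes (τ.permCongr σ)) := by
  have hasc : ∀ π : Equiv.Perm (Fin (m + 1)), m - ascCount π (Fin.last m) = #(finDes π) :=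
    fun π => by
      have := card_finDes_add_ascCount π
      omega
  have hle : ∀ π : Equiv.Perm (Fin (m + 1)), ascCount π (Fin.last m) ≤ m := fun π => by
    have := card_finDes_add_ascCount π
    omega
  choose Q hQ hQ0 using fun π : Equiv.Perm (Fin (m + 1)) => exists_choose_polynomial (hle π)
  refine ⟨∑ τ : Ω ≃ Fin (m + 1), Q (τ.permCongr σ), fun k => ?_, ?_⟩
  · rw [sum_sortCount_fin, Nat.cast_sum, mul_sum, eval_finsetSum, mul_sum]
    exact sum_congr rfl fun τ _ => hQ _ k
  · rw [eval_finsetSum]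
    exact sum_congr rfl fun τ _ => by rw [hQ0, hasc]

theorem sum_sortCount_rows_fin {n s r : ℕ} [NeZero r] (hn : Nat.card (Fin s × ZMod r) = n)
    (k : ℕ) : ((∑ f : Fin s × ZMod r → Fin k, sortCount n (rowShift s r) f : ℕ) : ℚ) =
      r ^ s * ∏ i ∈ range s, ((Nat.card (Neck r (Fin k)) : ℚ) + i) := by
  classical
  have : Fintype (Neck r (Fin k)) := Fintype.ofFinite _
  have h := sum_sortCount_rows (X := Fin k) hn (fun _ => True) fun _ _ _ => Iff.rfl
  simp only [if_true] at h
  rw [Nat.card_eq_fintype_card, ← sum_card_stabilizer, Nat.cast_sum]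
  convert h

open Polynomial in
theorem sum_desWeight_rowShift_ne_zero {m s r : ℕ} [NeZero r] (hr : Squarefree r) (hs : 1 ≤ s)
    (hn : Nat.card (Fin s × ZMod r) = m + 1) :
    ∑ τ : Fin s × ZMod r ≃ Fin (m + 1),
      desWeight m #(finDes (τ.permCongr (rowShift s r))) ≠ 0 := by
  obtain ⟨L, hL, hL0⟩ := exists_ascCount_polynomial (m := m) (rowShift s r)
  obtain ⟨ν, hν, hν0⟩ := exists_neck_polynomial hr
  obtain ⟨s, rfl⟩ := Nat.exists_eq_add_of_le' hs
  rw [← hL0]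
  let R : ℚ[X] := C (((m + 1).factorial : ℚ) * r ^ (s + 1)) * (ν * ∏ i ∈ range s,
    (X * ν + C ((i : ℚ) + 1)))
  have hLR : ∀ k : ℕ, (k : ℚ) * L.eval (k : ℚ) = k * R.eval (k : ℚ) := fun k => by
    rw [← hL, sum_sortCount_rows_fin hn, prod_range_succ', hν]
    simp only [R, eval_mul, eval_C, eval_prod, eval_add, eval_X]
    push_cast
    ring
  have hLR' : L = R := by
    refine eq_of_infinite_eval_eq _ _ (Set.Infinite.mono
      (s := Set.range fun k : ℕ => ((k + 1 : ℕ) : ℚ)) ?_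
      (Set.infinite_range_of_injective fun a b h => by
        have := Nat.cast_injective (R := ℚ) h
        omega))
    rintro _ ⟨k, rfl⟩
    exact mul_left_cancel₀ (Nat.cast_ne_zero.2 k.succ_ne_zero) (hLR (k + 1))
  rw [hLR']
  simp only [R, eval_mul, eval_C, eval_prod, eval_add, eval_X, zero_mul, zero_add]
  have h1 : ∏ i ∈ range s, ((i : ℚ) + 1) ≠ 0 := prod_ne_zero_iff.2 fun i _ => by positivity
  have h2 : (((m + 1).factorial : ℚ) * r ^ (s + 1)) ≠ 0 := mul_ne_zero
    (Nat.cast_ne_zero.2 (Nat.factorial_ne_zero _))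
    (pow_ne_zero _ (Nat.cast_ne_zero.2 (NeZero.ne r)))
  exact mul_ne_zero h2 (mul_ne_zero hν0 h1)

theorem not_hasCyclicExtension_of_squarefree {n s r : ℕ} [NeZero n] [NeZero r]
    (hr : Squarefree r) (hs : 1 ≤ s) (hn : Nat.card (Fin s × ZMod r) = n)
    (τ₁ : Fin s × ZMod r ≃ Fin n) (P : Multiset ℕ)
    (hP : fullCycleType (τ₁.permCongr (rowShift s r)) = P) :
    ¬ HasCyclicExtension n
      (fun π : {π : Equiv.Perm (Fin n) // fullCycleType π = P} => Des π.1) := by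
  obtain ⟨m, rfl⟩ := Nat.exists_eq_add_of_le' (NeZero.one_le (n := n))
  exact fun h => sum_desWeight_rowShift_ne_zero hr hs hn
    (sum_desWeight_eq_zero_of_hasCyclicExtension _ τ₁ P hP h)

theorem fullCycleType_permCongr_rowShift {n s r : ℕ} [NeZero n] [NeZero r]
    (hn : Nat.card (Fin s × ZMod r) = n) (τ : Fin s × ZMod r ≃ Fin n) :
    fullCycleType (τ.permCongr (rowShift s r)) = Multiset.replicate s r := by
  obtain ⟨s', h, hs'⟩ := exists_fullCycleType_eq_replicate (minimalPeriod_permCongr_rowShift τ)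
  rw [Nat.card_prod, Nat.card_fin, Nat.card_zmod, mul_comm, ← h] at hn
  rw [hs', Nat.eq_of_mul_eq_mul_left (NeZero.pos r) hn]

theorem hasCyclicExtension_replicate_iff {n r s : ℕ} [NeZero n] (hn : r * s = n) :
    HasCyclicExtension n (fun π : {π : Equiv.Perm (Fin n) //
      fullCycleType π = Multiset.replicate s r} => Des π.1) ↔ ¬ Squarefree r := by
  have hn0 := NeZero.ne n
  rw [← hn, mul_ne_zero_iff] at hn0
  have : NeZero r := ⟨hn0.1⟩
  have hs : 1 ≤ s := Nat.one_le_iff_ne_zero.2 hn0.2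
  have hcard : Nat.card (Fin s × ZMod r) = n := by
    rw [Nat.card_prod, Nat.card_fin, Nat.card_zmod, mul_comm, hn]
  let τ : Fin s × ZMod r ≃ Fin n := Finite.equivFinOfCardEq hcard
  have hτ := fullCycleType_permCongr_rowShift hcard τ
  refine ⟨fun h hr => not_hasCyclicExtension_of_squarefree hr hs hcard τ _ hτ h, fun hr => ?_⟩
  rw [Nat.squarefree_iff_prime_squarefree] at hr
  push Not at hr
  obtain ⟨q, hq, e, he⟩ := hr
  have : NeZero q := ⟨hq.ne_zero⟩
  have : NeZero (q * e) := ⟨fun h => NeZero.ne r (by rw [he, mul_assoc, h, mul_zero])⟩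
  exact hasCyclicExtension_of_squareful (q := q) (e := q * e) (by rw [he, mul_assoc])
    (dvd_mul_right _ _) hq.two_le hs hcard τ _ hτ

/-- The descent map on the conjugacy class `C_μ ⊆ S_n` has a cyclic extension
if and only if `μ` is not of the form `(r^s)` for a squarefree `r`. -/
theorem stmt0 (n : ℕ) (hn : 1 ≤ n) (μ : n.Partition) :
    HasCyclicExtension n
      (fun π : {π : Equiv.Perm (Fin n) // fullCycleType π = μ.parts} => Des π.1) ↔
    ¬ ∃ r s : ℕ, Squarefree r ∧ μ.parts = Multiset.replicate s r := by
  have : NeZero n := ⟨by omega⟩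
  have hsum : ∀ r s, μ.parts = Multiset.replicate s r → r * s = n := fun r s h => by
    rw [← μ.parts_sum, h, Multiset.sum_replicate, smul_eq_mul, mul_comm]
  constructor
  · rintro h ⟨r, s, hr, hμ⟩
    rw [hμ, hasCyclicExtension_replicate_iff (hsum r s hμ)] at h
    exact h hr
  · intro h
    by_cases hσ : ∃ σ : Equiv.Perm (Fin n), fullCycleType σ = μ.parts
    · obtain ⟨σ, hσ⟩ := hσ
      by_cases hp : ∀ x, Function.minimalPeriod σ x = Function.minimalPeriod σ 0
      · obtain ⟨s, hs, hrep⟩ := exists_fullCycleType_eq_replicate hp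
        rw [hσ] at hrep
        rw [hrep, hasCyclicExtension_replicate_iff hs]
        exact fun hr => h ⟨_, _, hr, hrep⟩
      · push Not at hp
        obtain ⟨x, hx⟩ := hp
        exact hasCyclicExtension_of_minimalPeriod_ne hσ hx
    · exact ⟨fun _ => ∅, Equiv.refl _, fun t => absurd ⟨t.1, t.2⟩ hσ⟩
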